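/- arXiv:1610.06519 — 8 statements merged into one kernel-verified Lean document; each statement's English description precedes it below -/
import Mathlib

section
/- Restricted kernel and duality gap: let N ⊂ X×Y, let K̂(x,y) := K(x,y) if (x,y) ∈ N and K̂(x,y) := 0 otherwise, let u : X → ℝ and v : Y → ℝ be strictly positive, α := ε·log u, β := ε·log v, and π(x,y) := u(x)·K̂(x,y)·v(y). Then ε·KL(π|K) + ε·KL*((α⊕β)/ε | K) = ε·KL(π|K̂) + ε·KL*((α⊕β)/ε | K̂) + ε·Σ_{(x,y)∉N} u(x)·K(x,y)·v(y), where (α⊕β)(x,y) := α(x)+β(y). (Since any marginal-penalty terms F_X(P_Xπ), F_Y(P_Yπ) and their conjugates appear identically in the full and restricted functionals, this is exactly the identity E(π) − J(α,β) = Ê(π) − Ĵ(α,β) + ε·Σ_{(x,y)∉N} u(x)K(x,y)v(y) between the primal-dual gaps of the full and restricted entropic transport problems.) -/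
open scoped Classical

/-- Discrete Kullback–Leibler divergence:
`KL(a|b) = Σ_{z : a z > 0} a z * log (a z / b z) − Σ_z a z + Σ_z b z`. -/
noncomputable def KLdiv {Z : Type*} [Fintype Z] (a b : Z → ℝ) : ℝ :=
  (∑ z, if 0 < a z then a z * Real.log (a z / b z) else 0) - ∑ z, a z + ∑ z, b z

/-- Conjugate of the Kullback–Leibler divergence:
`KL*(φ|b) = Σ_z (exp (φ z) − 1) * b z`. -/
noncomputable def KLstar {Z : Type*} [Fintype Z] (φ b : Z → ℝ) : ℝ :=
  ∑ z, (Real.exp (φ z) - 1) * b z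

/-- Restricted kernel and duality gap. -/
theorem restricted_kernel_duality_gap
    {X Y : Type*} [Fintype X] [Fintype Y] [Nonempty X] [Nonempty Y]
    (ρ : X → Y → ℝ) (hρ : ∀ x y, 0 ≤ ρ x y)
    (c : X → Y → ℝ) (ε : ℝ) (hε : 0 < ε)
    (N : Set (X × Y))
    (K Khat : X → Y → ℝ)
    (hK : ∀ x y, K x y = Real.exp (-(c x y) / ε) * ρ x y)
    (hKhat : ∀ x y, Khat x y = if (x, y) ∈ N then K x y else 0)
    (u : X → ℝ) (v : Y → ℝ) (hu : ∀ x, 0 < u x) (hv : ∀ y, 0 < v y)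
    (α : X → ℝ) (β : Y → ℝ)
    (hα : ∀ x, α x = ε * Real.log (u x)) (hβ : ∀ y, β y = ε * Real.log (v y))
    (π : X → Y → ℝ) (hπ : ∀ x y, π x y = u x * Khat x y * v y)
    (φ : X × Y → ℝ) (hφ : ∀ p : X × Y, φ p = (α p.1 + β p.2) / ε) :
    ε * KLdiv (fun p : X × Y => π p.1 p.2) (fun p : X × Y => K p.1 p.2)
      + ε * KLstar φ (fun p : X × Y => K p.1 p.2)
    = ε * KLdiv (fun p : X × Y => π p.1 p.2) (fun p : X × Y => Khat p.1 p.2)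
      + ε * KLstar φ (fun p : X × Y => Khat p.1 p.2)
      + ε * ∑ x, ∑ y, (if (x, y) ∈ N then 0 else u x * K x y * v y) := by
  have hexp : ∀ x y, Real.exp (φ (x, y)) = u x * v y := by
    intro x y
    rw [hφ, hα, hβ, ← mul_add, mul_div_cancel_left₀ _ hε.ne', Real.exp_add,
      Real.exp_log (hu x), Real.exp_log (hv y)]
  rw [← Fintype.sum_prod_type' (fun x y => if (x, y) ∈ N then (0 : ℝ) else u x * K x y * v y)]
  simp only [KLdiv, KLstar, ← mul_add]
  congr 1
  simp only [← Finset.sum_add_distrib, ← Finset.sum_sub_distrib]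
  refine Finset.sum_congr rfl fun p _ => ?_
  obtain ⟨x, y⟩ := p
  rw [hexp]
  by_cases h : (x, y) ∈ N
  · simp [hπ, hKhat, h]
  · simp only [hπ, hKhat, h, if_false, mul_zero, zero_mul, lt_irrefl]
    ring
end

section
/- Duality gap estimate for truncation: let α̂ : X → ℝ, β̂ : Y → ℝ, θ > 0, let N := {(x,y) ∈ X×Y : exp(−(c(x,y)−α̂(x)−β̂(y))/ε) ≥ θ}, let ũ : X → ℝ and ṽ : Y → ℝ be strictly positive, and set u(x) := ũ(x)·exp(α̂(x)/ε), v(y) := ṽ(y)·exp(β̂(y)/ε). Then Σ_{(x,y)∉N} u(x)·K(x,y)·v(y) ≤ ‖ũ‖_∞ · ‖ṽ‖_∞ · θ · Σ_{x,y} ρ(x,y). Consequently, with K̂ := K·1_N and π(x,y) := u(x)K̂(x,y)v(y), the primal-dual gap of the full problem exceeds that of the restricted problem by at most ε·‖ũ‖_∞·‖ṽ‖_∞·θ·Σ_{x,y} ρ(x,y). -/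
open scoped Classical

/-- Replacing the second argument of `KLdiv` off the support of the first only changes the
total mass term. -/
lemma KLdiv_sub_KLdiv_of_eq_on_support {Z : Type*} [Fintype Z] (a b b' : Z → ℝ)
    (h : ∀ z, 0 < a z → b z = b' z) :
    KLdiv a b - KLdiv a b' = ∑ z, (b z - b' z) := by
  have hlog : (∑ z, if 0 < a z then a z * Real.log (a z / b z) else 0) =
      ∑ z, if 0 < a z then a z * Real.log (a z / b' z) else 0 := by
    refine Finset.sum_congr rfl fun z _ => ?_
    split_ifs with hz
    · rw [h z hz]
    · rfl
  rw [KLdiv, KLdiv, hlog, Finset.sum_sub_distrib]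
  ring

lemma KLstar_sub_KLstar {Z : Type*} [Fintype Z] (φ b b' : Z → ℝ) :
    KLstar φ b - KLstar φ b' = ∑ z, (Real.exp (φ z) - 1) * (b z - b' z) := by
  simp only [KLstar, mul_sub, Finset.sum_sub_distrib]

/-- If `b` and `b'` agree on the support of `a`, the primal-dual objectives for `b` and `b'`
differ by the `exp φ`-weighted mass of `b - b'`. -/
lemma KLdiv_add_KLstar_sub {Z : Type*} [Fintype Z] (a b b' φ : Z → ℝ)
    (h : ∀ z, 0 < a z → b z = b' z) :
    (KLdiv a b + KLstar φ b) - (KLdiv a b' + KLstar φ b') =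
      ∑ z, Real.exp (φ z) * (b z - b' z) := by
  rw [add_sub_add_comm, KLdiv_sub_KLdiv_of_eq_on_support a b b' h, KLstar_sub_KLstar,
    ← Finset.sum_add_distrib]
  exact Finset.sum_congr rfl fun z _ => by ring

/-- Duality gap estimate for kernel truncation. -/
theorem truncation_duality_gap_estimate
    {X Y : Type*} [Fintype X] [Fintype Y] [Nonempty X] [Nonempty Y]
    (ρ : X → Y → ℝ) (hρ : ∀ x y, 0 ≤ ρ x y)
    (c : X → Y → ℝ) (ε : ℝ) (hε : 0 < ε)
    (αh : X → ℝ) (βh : Y → ℝ) (θ : ℝ) (hθ : 0 < θ)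
    (N : Set (X × Y))
    (hN : N = {p : X × Y | θ ≤ Real.exp (-(c p.1 p.2 - αh p.1 - βh p.2) / ε)})
    (ut : X → ℝ) (vt : Y → ℝ) (hut : ∀ x, 0 < ut x) (hvt : ∀ y, 0 < vt y)
    (u : X → ℝ) (v : Y → ℝ)
    (hu : ∀ x, u x = ut x * Real.exp (αh x / ε))
    (hv : ∀ y, v y = vt y * Real.exp (βh y / ε))
    (K Khat : X → Y → ℝ)
    (hK : ∀ x y, K x y = Real.exp (-(c x y) / ε) * ρ x y)
    (hKhat : ∀ x y, Khat x y = if (x, y) ∈ N then K x y else 0)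
    (α : X → ℝ) (β : Y → ℝ)
    (hα : ∀ x, α x = ε * Real.log (u x)) (hβ : ∀ y, β y = ε * Real.log (v y))
    (π : X → Y → ℝ) (hπ : ∀ x y, π x y = u x * Khat x y * v y)
    (φ : X × Y → ℝ) (hφ : ∀ p : X × Y, φ p = (α p.1 + β p.2) / ε) :
    (∑ x, ∑ y, (if (x, y) ∈ N then 0 else u x * K x y * v y))
      ≤ (Finset.univ.sup' Finset.univ_nonempty fun x => |ut x|) *
        (Finset.univ.sup' Finset.univ_nonempty fun y => |vt y|) * θ * ∑ x, ∑ y, ρ x y ∧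
    ε * KLdiv (fun p : X × Y => π p.1 p.2) (fun p : X × Y => K p.1 p.2)
      + ε * KLstar φ (fun p : X × Y => K p.1 p.2)
    ≤ ε * KLdiv (fun p : X × Y => π p.1 p.2) (fun p : X × Y => Khat p.1 p.2)
      + ε * KLstar φ (fun p : X × Y => Khat p.1 p.2)
      + ε * ((Finset.univ.sup' Finset.univ_nonempty fun x => |ut x|) *
          (Finset.univ.sup' Finset.univ_nonempty fun y => |vt y|) * θ * ∑ x, ∑ y, ρ x y) := by
  have hupos : ∀ x, 0 < u x := fun x => by rw [hu]; exact mul_pos (hut x) (Real.exp_pos _)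
  have hvpos : ∀ y, 0 < v y := fun y => by rw [hv]; exact mul_pos (hvt y) (Real.exp_pos _)
  have hmass : (∑ x, ∑ y, (if (x, y) ∈ N then 0 else u x * K x y * v y))
      ≤ (Finset.univ.sup' Finset.univ_nonempty fun x => |ut x|) *
        (Finset.univ.sup' Finset.univ_nonempty fun y => |vt y|) * θ * ∑ x, ∑ y, ρ x y := by
    simp only [Finset.mul_sum]
    refine Finset.sum_le_sum fun x _ => Finset.sum_le_sum fun y _ => ?_
    have hx : ut x ≤ Finset.univ.sup' Finset.univ_nonempty fun x => |ut x| :=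
      (le_abs_self _).trans (Finset.le_sup' (fun x => |ut x|) (Finset.mem_univ x))
    have hy : vt y ≤ Finset.univ.sup' Finset.univ_nonempty fun y => |vt y| :=
      (le_abs_self _).trans (Finset.le_sup' (fun y => |vt y|) (Finset.mem_univ y))
    have hx0 := (hut x).le.trans hx
    have hy0 := (hvt y).le.trans hy
    have hρ0 := hρ x y
    split_ifs with hxy
    · positivity
    · have hlt : Real.exp (-(c x y - αh x - βh y) / ε) < θ := by
        simpa [hN] using hxy
      have hexp : Real.exp (-(c x y - αh x - βh y) / ε) =
          Real.exp (αh x / ε) * Real.exp (-(c x y) / ε) * Real.exp (βh y / ε) := by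
        rw [← Real.exp_add, ← Real.exp_add]
        ring_nf
      calc u x * K x y * v y
          = ut x * vt y * Real.exp (-(c x y - αh x - βh y) / ε) * ρ x y := by
            rw [hu, hv, hK, hexp]
            ring
        _ ≤ _ := by
            have := (hvt y).le
            gcongr
  refine ⟨hmass, ?_⟩
  have hgap := KLdiv_add_KLstar_sub (fun p : X × Y => π p.1 p.2) (fun p => K p.1 p.2)
    (fun p => Khat p.1 p.2) φ (fun p hp => by
      by_cases hpN : (p.1, p.2) ∈ N
      · simp only [hKhat, if_pos hpN]
      · simp [hπ, hKhat, if_neg hpN] at hp)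
  have hexpφ : ∀ p : X × Y, Real.exp (φ p) = u p.1 * v p.2 := fun p => by
    rw [hφ, hα, hβ, ← mul_add, mul_div_cancel_left₀ _ hε.ne', Real.exp_add,
      Real.exp_log (hupos _), Real.exp_log (hvpos _)]
  have hsum : ∑ p : X × Y, Real.exp (φ p) * (K p.1 p.2 - Khat p.1 p.2) =
      ∑ x, ∑ y, (if (x, y) ∈ N then 0 else u x * K x y * v y) := by
    rw [Fintype.sum_prod_type]
    refine Finset.sum_congr rfl fun x _ => Finset.sum_congr rfl fun y _ => ?_
    rw [hexpφ, hKhat]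
    split_ifs <;> ring
  rw [← mul_add, ← mul_add, ← mul_add]
  refine mul_le_mul_of_nonneg_left ?_ hε.le
  linarith
end

section
/- Monotonicity of the asynchronous Sinkhorn algorithm: for every ℓ ≥ 1 one has u^{ℓ+1}(x) ≥ u^ℓ(x) for all x ∈ X, v̂^{ℓ+1}(y) ≤ v̂^ℓ(y) for all y ∈ Y, v^{ℓ+1}(y) ≤ v^ℓ(y) for all y ∈ Y, and q^{ℓ+1} ≥ q^ℓ. -/
/-- One `u`-update of the Sinkhorn algorithm: `u(x) = μ(x) / Σ_y K(x,y) v(y)`. -/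
noncomputable def uOf {X Y : Type*} [Fintype Y] (K : X → Y → ℝ) (μ : X → ℝ)
    (v : Y → ℝ) : X → ℝ :=
  fun x => μ x / ∑ y, K x y * v y

/-- One `v̂`-update of the Sinkhorn algorithm: `v̂(y) = ν(y) / Σ_x K(x,y) u(x)`. -/
noncomputable def vhatOf {X Y : Type*} [Fintype X] (K : X → Y → ℝ) (ν : Y → ℝ)
    (u : X → ℝ) : Y → ℝ :=
  fun y => ν y / ∑ x, K x y * u x

/-- The `v`-iterates of the asynchronous Sinkhorn algorithm:
`v⁰ = v0`, `v^{ℓ+1}(y) = min (v^ℓ(y), v̂^{ℓ+1}(y))` with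
`v̂^{ℓ+1} = vhatOf K ν (uOf K μ (v^ℓ))`. -/
noncomputable def sinkV {X Y : Type*} [Fintype X] [Fintype Y] (K : X → Y → ℝ)
    (μ : X → ℝ) (ν : Y → ℝ) (v0 : Y → ℝ) : ℕ → Y → ℝ
  | 0 => v0
  | ℓ + 1 => fun y =>
      min (sinkV K μ ν v0 ℓ y) (vhatOf K ν (uOf K μ (sinkV K μ ν v0 ℓ)) y)

theorem uOf_pos {X Y : Type*} [Fintype Y] [Nonempty Y] {K : X → Y → ℝ} {μ : X → ℝ} {v : Y → ℝ}
    (hK : ∀ x y, 0 < K x y) (hμ : ∀ x, 0 < μ x) (hv : ∀ y, 0 < v y) (x : X) :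
    0 < uOf K μ v x :=
  div_pos (hμ x) (Finset.sum_pos (fun y _ => mul_pos (hK x y) (hv y)) Finset.univ_nonempty)

theorem vhatOf_pos {X Y : Type*} [Fintype X] [Nonempty X] {K : X → Y → ℝ} {ν : Y → ℝ} {u : X → ℝ}
    (hK : ∀ x y, 0 < K x y) (hν : ∀ y, 0 < ν y) (hu : ∀ x, 0 < u x) (y : Y) :
    0 < vhatOf K ν u y :=
  div_pos (hν y) (Finset.sum_pos (fun x _ => mul_pos (hK x y) (hu x)) Finset.univ_nonempty)

theorem uOf_anti {X Y : Type*} [Fintype Y] [Nonempty Y] {K : X → Y → ℝ} {μ : X → ℝ}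
    {v w : Y → ℝ} (hK : ∀ x y, 0 < K x y) (hμ : ∀ x, 0 < μ x) (hv : ∀ y, 0 < v y)
    (hvw : ∀ y, v y ≤ w y) (x : X) : uOf K μ w x ≤ uOf K μ v x :=
  div_le_div_of_nonneg_left (hμ x).le
    (Finset.sum_pos (fun y _ => mul_pos (hK x y) (hv y)) Finset.univ_nonempty)
    (Finset.sum_le_sum fun y _ => mul_le_mul_of_nonneg_left (hvw y) (hK x y).le)

theorem vhatOf_anti {X Y : Type*} [Fintype X] [Nonempty X] {K : X → Y → ℝ} {ν : Y → ℝ}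
    {u w : X → ℝ} (hK : ∀ x y, 0 < K x y) (hν : ∀ y, 0 < ν y) (hu : ∀ x, 0 < u x)
    (huw : ∀ x, u x ≤ w x) (y : Y) : vhatOf K ν w y ≤ vhatOf K ν u y :=
  div_le_div_of_nonneg_left (hν y).le
    (Finset.sum_pos (fun x _ => mul_pos (hK x y) (hu x)) Finset.univ_nonempty)
    (Finset.sum_le_sum fun x _ => mul_le_mul_of_nonneg_left (huw x) (hK x y).le)

theorem sinkV_pos {X Y : Type*} [Fintype X] [Fintype Y] [Nonempty X] [Nonempty Y]
    {K : X → Y → ℝ} {μ : X → ℝ} {ν v0 : Y → ℝ} (hK : ∀ x y, 0 < K x y) (hμ : ∀ x, 0 < μ x)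
    (hν : ∀ y, 0 < ν y) (hv0 : ∀ y, 0 < v0 y) (ℓ : ℕ) : ∀ y, 0 < sinkV K μ ν v0 ℓ y := by
  induction ℓ with
  | zero => exact hv0
  | succ n ih => exact fun y => lt_min (ih y) (vhatOf_pos hK hν (uOf_pos hK hμ ih) y)

theorem sinkV_succ_le {X Y : Type*} [Fintype X] [Fintype Y] (K : X → Y → ℝ) (μ : X → ℝ)
    (ν v0 : Y → ℝ) (ℓ : ℕ) (y : Y) : sinkV K μ ν v0 (ℓ + 1) y ≤ sinkV K μ ν v0 ℓ y :=
  min_le_left _ _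

/-- The column marginals of the primal iterates are nondecreasing. -/
theorem sum_mul_min_vhatOf_mono {X Y : Type*} [Fintype X] [Nonempty X] {K : X → Y → ℝ}
    {ν : Y → ℝ} {u w : X → ℝ} {v : Y → ℝ} (hK : ∀ x y, 0 < K x y) (hu : ∀ x, 0 < u x)
    (huw : ∀ x, u x ≤ w x) {y : Y} (hv : 0 ≤ v y) (hvu : v y ≤ vhatOf K ν u y) :
    (∑ x, K x y * u x) * v y ≤ (∑ x, K x y * w x) * min (v y) (vhatOf K ν w y) := by
  have hSu : 0 < ∑ x, K x y * u x :=
    Finset.sum_pos (fun x _ => mul_pos (hK x y) (hu x)) Finset.univ_nonempty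
  have hSuw : ∑ x, K x y * u x ≤ ∑ x, K x y * w x :=
    Finset.sum_le_sum fun x _ => mul_le_mul_of_nonneg_left (huw x) (hK x y).le
  have hSw := hSu.trans_le hSuw
  rw [mul_min_of_nonneg _ _ hSw.le]
  refine le_min (mul_le_mul_of_nonneg_right hSuw hv) ?_
  rw [vhatOf, mul_div_cancel₀ _ hSw.ne']
  rw [vhatOf, le_div_iff₀ hSu] at hvu
  linarith

theorem async_sinkhorn_monotone
    {X Y : Type*} [Fintype X] [Fintype Y] [Nonempty X] [Nonempty Y]
    (μ : X → ℝ) (ν : Y → ℝ) (hμ : ∀ x, 0 < μ x) (hν : ∀ y, 0 < ν y)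
    (hμ1 : ∑ x, μ x = 1) (hν1 : ∑ y, ν y = 1)
    (C : ℝ) (hC : 0 ≤ C) (c : X → Y → ℝ) (hc : ∀ x y, 0 ≤ c x y ∧ c x y ≤ C)
    (ε : ℝ) (hε : 0 < ε)
    (K : X → Y → ℝ) (hK : ∀ x y, K x y = Real.exp (-(c x y) / ε) * μ x * ν y)
    (v0 : Y → ℝ) (hv0 : ∀ y, 0 < v0 y)
    (v : ℕ → Y → ℝ) (hv : ∀ ℓ, v ℓ = sinkV K μ ν v0 ℓ)
    (u : ℕ → X → ℝ) (hu : ∀ ℓ, u ℓ = uOf K μ (v (ℓ - 1)))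
    (vhat : ℕ → Y → ℝ) (hvhat : ∀ ℓ, vhat ℓ = vhatOf K ν (u ℓ))
    (π : ℕ → X → Y → ℝ) (hπ : ∀ ℓ x y, π ℓ x y = u ℓ x * K x y * v ℓ y)
    (q : ℕ → ℝ) (hq : ∀ ℓ, q ℓ = ∑ x, ∑ y, π ℓ x y)
    (α : ℕ → X → ℝ) (hα : ∀ ℓ x, α ℓ x = ε * Real.log (u ℓ x)) :
    ∀ ℓ : ℕ, 1 ≤ ℓ →
      (∀ x, u ℓ x ≤ u (ℓ + 1) x) ∧
      (∀ y, vhat (ℓ + 1) y ≤ vhat ℓ y) ∧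
      (∀ y, v (ℓ + 1) y ≤ v ℓ y) ∧
      q ℓ ≤ q (ℓ + 1) := by
  have hKpos : ∀ x y, 0 < K x y := fun x y => by
    rw [hK]
    exact mul_pos (mul_pos (Real.exp_pos _) (hμ x)) (hν y)
  have hvpos := sinkV_pos (v0 := v0) hKpos hμ hν hv0
  rintro ℓ hℓ
  obtain ⟨n, rfl⟩ := Nat.exists_eq_add_of_le' hℓ
  have hu_pos : ∀ x, 0 < u (n + 1) x := by
    rw [hu, hv]
    exact uOf_pos hKpos hμ (hvpos _)
  have hu_mono : ∀ x, u (n + 1) x ≤ u (n + 1 + 1) x := by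
    rw [hu, hu, hv, hv]
    exact uOf_anti hKpos hμ (hvpos _) (sinkV_succ_le K μ ν v0 n)
  have hv_succ : ∀ k y, v (k + 1) y = min (v k y) (vhatOf K ν (u (k + 1)) y) := by
    intro k y
    rw [hu, hv, hv, Nat.add_sub_cancel, hv, sinkV]
  have hq_eq : ∀ k, q k = ∑ y, (∑ x, K x y * u k x) * v k y := by
    intro k
    simp_rw [hq, hπ, Finset.sum_mul]
    rw [Finset.sum_comm]
    simp_rw [mul_comm (K _ _)]
  refine ⟨hu_mono, ?_, ?_, ?_⟩
  · rw [hvhat, hvhat]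
    exact vhatOf_anti hKpos hν hu_pos hu_mono
  · rw [hv, hv]
    exact sinkV_succ_le K μ ν v0 (n + 1)
  · rw [hq_eq, hq_eq]
    refine Finset.sum_le_sum fun y _ => ?_
    rw [hv_succ (n + 1)]
    refine sum_mul_min_vhatOf_mono hKpos hu_pos hu_mono ?_ ?_
    · rw [hv]
      exact (hvpos _ y).le
    · rw [hv_succ]
      exact min_le_right _ _
end

section
/- Let X₀ ⊂ X and Y₀ ⊂ Y be such that the assignment graph has no edge from a vertex of X₀ ∪ Y₀ to a vertex outside X₀ ∪ Y₀ (i.e. π₂(x,y) < μ(x)ν(y)/M whenever x ∈ X₀ and y ∉ Y₀, and π₁(x,y) < μ(x)ν(y)/M whenever y ∈ Y₀ and x ∉ X₀). Then |μ(X₀) − ν(Y₀)| < 1/M. The same conclusion holds if instead there is no edge from a vertex outside X₀ ∪ Y₀ to a vertex of X₀ ∪ Y₀. If moreover M is a positive integer and M·μ(x), M·ν(y) are positive integers for all x ∈ X, y ∈ Y, then μ(X₀) = ν(Y₀). -/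
/-- The assignment graph of two couplings `π₁`, `π₂` with threshold `1/M`:
an edge `x → y` iff `π₂ x y ≥ μ x * ν y / M`, and an edge `y → x` iff
`π₁ x y ≥ μ x * ν y / M`. -/
def assignEdge {X Y : Type*} (π₁ π₂ : X → Y → ℝ) (μ : X → ℝ) (ν : Y → ℝ) (M : ℝ) :
    X ⊕ Y → X ⊕ Y → Prop
  | Sum.inl x, Sum.inr y => μ x * ν y / M ≤ π₂ x y
  | Sum.inr y, Sum.inl x => μ x * ν y / M ≤ π₁ x y
  | _, _ => False

open Finset in
/-- If a coupling is pointwise below `μ ⊗ ν / M` on `A × C`, then its mass there is below `1 / M`,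
which bounds `μ(A) + ν(C)`. -/
lemma coupling_sum_add_sum_lt {X Y : Type*} [Fintype X] [Fintype Y]
    {μ : X → ℝ} {ν : Y → ℝ} (hμ : ∀ x, 0 ≤ μ x) (hν : ∀ y, 0 ≤ ν y)
    (hμ1 : ∑ x, μ x = 1) (hν1 : ∑ y, ν y = 1) {π : X → Y → ℝ}
    (hpos : ∀ x y, 0 ≤ π x y) (hrow : ∀ x, ∑ y, π x y = μ x) (hcol : ∀ y, ∑ x, π x y = ν y)
    {M : ℝ} (hM : 0 < M) {A : Finset X} {C : Finset Y}
    (h : ∀ x ∈ A, ∀ y ∈ C, π x y < μ x * ν y / M) :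
    ∑ x ∈ A, μ x + ∑ y ∈ C, ν y < 1 + 1 / M := by
  classical
  have hmass : ∑ x ∈ A, ∑ y ∈ C, π x y < 1 / M := by
    rw [← sum_product']
    rcases (A ×ˢ C).eq_empty_or_nonempty with hAC | hAC
    · rw [hAC, sum_empty]
      positivity
    · calc ∑ p ∈ A ×ˢ C, π p.1 p.2 < ∑ p ∈ A ×ˢ C, μ p.1 * ν p.2 / M :=
            sum_lt_sum_of_nonempty hAC fun p hp =>
              h p.1 (mem_product.1 hp).1 p.2 (mem_product.1 hp).2
        _ ≤ ∑ p : X × Y, μ p.1 * ν p.2 / M :=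
            sum_le_univ_sum_of_nonneg fun p =>
              div_nonneg (mul_nonneg (hμ p.1) (hν p.2)) hM.le
        _ = 1 / M := by
            rw [← sum_div, Fintype.sum_prod_type, ← Fintype.sum_mul_sum, hμ1, hν1, one_mul]
  have hA : ∑ x ∈ A, μ x = ∑ x ∈ A, ∑ y ∈ C, π x y + ∑ x ∈ A, ∑ y ∈ Cᶜ, π x y := by
    rw [← sum_add_distrib]
    exact sum_congr rfl fun x _ => by rw [sum_add_sum_compl, hrow]
  have hrest : ∑ x ∈ A, ∑ y ∈ Cᶜ, π x y ≤ ∑ y ∈ Cᶜ, ν y := by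
    calc ∑ x ∈ A, ∑ y ∈ Cᶜ, π x y ≤ ∑ x, ∑ y ∈ Cᶜ, π x y :=
          sum_le_univ_sum_of_nonneg fun x => sum_nonneg fun y _ => hpos x y
      _ = ∑ y ∈ Cᶜ, ν y := by
          rw [sum_comm]
          exact sum_congr rfl fun y _ => hcol y
  have hC := sum_add_sum_compl C ν
  linarith

/-- A finite sum of reals that become natural numbers when multiplied by `M` has the same
property. -/
lemma exists_nat_eq_mul_sum {ι : Type*} {M : ℝ} {f : ι → ℝ}
    (hf : ∀ i, ∃ k : ℕ, M * f i = k) (s : Finset ι) : ∃ k : ℕ, M * ∑ i ∈ s, f i = k := by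
  choose k hk using hf
  exact ⟨∑ i ∈ s, k i, by simp [Finset.mul_sum, hk]⟩

/-- Two reals closer than `1 / M` whose multiples by `M` are natural numbers are equal. -/
lemma eq_of_abs_sub_lt_one_div {M a b : ℝ} (hM : 0 < M) (ha : ∃ k : ℕ, M * a = k)
    (hb : ∃ k : ℕ, M * b = k) (h : |a - b| < 1 / M) : a = b := by
  obtain ⟨k, hk⟩ := ha
  obtain ⟨l, hl⟩ := hb
  have hdiff : |(k : ℝ) - l| = M * |a - b| := by
    rw [← hk, ← hl, ← mul_sub, abs_mul, abs_of_pos hM]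
  rw [lt_div_iff₀' hM, ← hdiff] at h
  have hkl : |(k : ℤ) - l| < 1 := by exact_mod_cast h
  have hkl' : k = l := by
    rw [Int.abs_lt_one_iff] at hkl
    omega
  exact mul_left_cancel₀ hM.ne' (by rw [hk, hl, hkl'])

/-- If `(X₀, Y₀)` has no outgoing (or no incoming) edges in the assignment
graph, then `|μ(X₀) − ν(Y₀)| < 1/M`; under the atomic-mass assumption even
`μ(X₀) = ν(Y₀)`. -/
theorem assignment_graph_balanced
    {X Y : Type*} [Fintype X] [Fintype Y] [Nonempty X] [Nonempty Y]
    (μ : X → ℝ) (ν : Y → ℝ) (hμ : ∀ x, 0 < μ x) (hν : ∀ y, 0 < ν y)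
    (hμ1 : ∑ x, μ x = 1) (hν1 : ∑ y, ν y = 1)
    (π₁ π₂ : X → Y → ℝ)
    (hπ₁pos : ∀ x y, 0 ≤ π₁ x y) (hπ₁row : ∀ x, ∑ y, π₁ x y = μ x)
    (hπ₁col : ∀ y, ∑ x, π₁ x y = ν y)
    (hπ₂pos : ∀ x y, 0 ≤ π₂ x y) (hπ₂row : ∀ x, ∑ y, π₂ x y = μ x)
    (hπ₂col : ∀ y, ∑ x, π₂ x y = ν y)
    (M : ℝ) (hM : 0 < M)
    (X₀ : Finset X) (Y₀ : Finset Y) :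
    (((∀ x ∈ X₀, ∀ y, y ∉ Y₀ → π₂ x y < μ x * ν y / M) ∧
      (∀ y ∈ Y₀, ∀ x, x ∉ X₀ → π₁ x y < μ x * ν y / M)) →
        |(∑ x ∈ X₀, μ x) - ∑ y ∈ Y₀, ν y| < 1 / M) ∧
    (((∀ x, x ∉ X₀ → ∀ y ∈ Y₀, π₂ x y < μ x * ν y / M) ∧
      (∀ y, y ∉ Y₀ → ∀ x ∈ X₀, π₁ x y < μ x * ν y / M)) →
        |(∑ x ∈ X₀, μ x) - ∑ y ∈ Y₀, ν y| < 1 / M) ∧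
    ((∃ m : ℕ, 0 < m ∧ M = (m : ℝ)) →
     (∀ x, ∃ k : ℕ, 0 < k ∧ M * μ x = (k : ℝ)) →
     (∀ y, ∃ k : ℕ, 0 < k ∧ M * ν y = (k : ℝ)) →
      (((∀ x ∈ X₀, ∀ y, y ∉ Y₀ → π₂ x y < μ x * ν y / M) ∧
        (∀ y ∈ Y₀, ∀ x, x ∉ X₀ → π₁ x y < μ x * ν y / M)) →
          (∑ x ∈ X₀, μ x) = ∑ y ∈ Y₀, ν y) ∧
      (((∀ x, x ∉ X₀ → ∀ y ∈ Y₀, π₂ x y < μ x * ν y / M) ∧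
        (∀ y, y ∉ Y₀ → ∀ x ∈ X₀, π₁ x y < μ x * ν y / M)) →
          (∑ x ∈ X₀, μ x) = ∑ y ∈ Y₀, ν y)) := by
  classical
  have balanced : ∀ {π π' : X → Y → ℝ}, (∀ x y, 0 ≤ π x y) → (∀ x, ∑ y, π x y = μ x) →
      (∀ y, ∑ x, π x y = ν y) → (∀ x y, 0 ≤ π' x y) → (∀ x, ∑ y, π' x y = μ x) →
      (∀ y, ∑ x, π' x y = ν y) → (∀ x ∈ X₀, ∀ y, y ∉ Y₀ → π x y < μ x * ν y / M) →
      (∀ y ∈ Y₀, ∀ x, x ∉ X₀ → π' x y < μ x * ν y / M) →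
      |(∑ x ∈ X₀, μ x) - ∑ y ∈ Y₀, ν y| < 1 / M := by
    intro π π' hpos hrow hcol hpos' hrow' hcol' h h'
    have hlt := coupling_sum_add_sum_lt (A := X₀) (C := Y₀ᶜ) (fun x => (hμ x).le)
      (fun y => (hν y).le) hμ1 hν1 hpos hrow hcol hM
      fun x hx y hy => h x hx y (Finset.mem_compl.1 hy)
    have hlt' := coupling_sum_add_sum_lt (A := X₀ᶜ) (C := Y₀) (fun x => (hμ x).le)
      (fun y => (hν y).le) hμ1 hν1 hpos' hrow' hcol' hM
      fun x hx y hy => h' y hy x (Finset.mem_compl.1 hx)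
    have hX := Finset.sum_add_sum_compl X₀ μ
    have hY := Finset.sum_add_sum_compl Y₀ ν
    rw [abs_lt]
    constructor <;> linarith
  have outgoing := balanced hπ₂pos hπ₂row hπ₂col hπ₁pos hπ₁row hπ₁col
  have incoming := balanced hπ₁pos hπ₁row hπ₁col hπ₂pos hπ₂row hπ₂col
  refine ⟨fun h => outgoing h.1 h.2,
    fun h => incoming (fun x hx y hy => h.2 y hy x hx) fun y hy x hx => h.1 x hx y hy,
    fun _ hMμ hMν => ?_⟩
  have eq_of_lt := eq_of_abs_sub_lt_one_div hM
    (exists_nat_eq_mul_sum (fun x => (hMμ x).imp fun _ hk => hk.2) X₀)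
    (exists_nat_eq_mul_sum (fun y => (hMν y).imp fun _ hk => hk.2) Y₀)
  exact ⟨fun h => eq_of_lt (outgoing h.1 h.2), fun h => eq_of_lt
    (incoming (fun x hx y hy => h.2 y hy x hx) fun y hy x hx => h.1 x hx y hy)⟩
end

section
/- Assume M is a positive integer and M·μ(x), M·ν(y) are positive integers for all x ∈ X, y ∈ Y. Call two vertices a, b of the assignment graph mutually reachable if there is a directed path from a to b and a directed path from b to a (every vertex is mutually reachable from itself); this is an equivalence relation, and each equivalence class (strongly connected component) is of the form X_i ∪ Y_i with X_i ⊂ X and Y_i ⊂ Y. Then the sets X_i form a partition of X, the sets Y_i form a partition of Y, and μ(X_i) = ν(Y_i) for every strongly connected component. -/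
open scoped Classical

/-- If a coupling puts less than `μ x * ν y / M` on every pair in `A × Bᶜ`, then `A` has at most
the mass of `B`, provided all masses are integer multiples of `1 / M`. -/
theorem sum_le_sum_of_coupling_lt {X Y : Type*} [Fintype X] [Fintype Y]
    {μ : X → ℝ} {ν : Y → ℝ} (hμ : ∀ x, 0 ≤ μ x) (hν : ∀ y, 0 ≤ ν y)
    (hμ1 : ∑ x, μ x = 1) (hν1 : ∑ y, ν y = 1)
    {π : X → Y → ℝ} (hpos : ∀ x y, 0 ≤ π x y) (hrow : ∀ x, ∑ y, π x y = μ x)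
    (hcol : ∀ y, ∑ x, π x y = ν y) {M : ℕ} (hM : 0 < M)
    (hμint : ∀ x, ∃ k : ℕ, (M : ℝ) * μ x = k) (hνint : ∀ y, ∃ k : ℕ, (M : ℝ) * ν y = k)
    (A : Finset X) (B : Finset Y)
    (hlt : ∀ x ∈ A, ∀ y ∈ Bᶜ, π x y < μ x * ν y / M) :
    ∑ x ∈ A, μ x ≤ ∑ y ∈ B, ν y := by
  have hM' : (0 : ℝ) < M := by exact_mod_cast hM
  have inside : ∑ x ∈ A, ∑ y ∈ B, π x y ≤ ∑ y ∈ B, ν y := by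
    rw [Finset.sum_comm]
    refine Finset.sum_le_sum fun y _ => ?_
    rw [← hcol y]
    exact Finset.sum_le_univ_sum_of_nonneg fun x => hpos x y
  have outside : ∑ x ∈ A, ∑ y ∈ Bᶜ, π x y < 1 / M := by
    rcases A.eq_empty_or_nonempty with rfl | hA
    · simpa using hM
    rcases Bᶜ.eq_empty_or_nonempty with hB | hB
    · simpa [hB] using hM
    calc ∑ x ∈ A, ∑ y ∈ Bᶜ, π x y
        < ∑ x ∈ A, ∑ y ∈ Bᶜ, μ x * ν y / M :=
          Finset.sum_lt_sum_of_nonempty hA fun x hx =>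
            Finset.sum_lt_sum_of_nonempty hB fun y hy => hlt x hx y hy
      _ = (∑ x ∈ A, μ x) * (∑ y ∈ Bᶜ, ν y) / M := by
          rw [Finset.sum_mul_sum, Finset.sum_div]
          simp_rw [Finset.sum_div]
      _ ≤ 1 / M := by
          gcongr
          refine mul_le_one₀ ?_ (Finset.sum_nonneg fun y _ => hν y) ?_
          · exact hμ1 ▸ Finset.sum_le_univ_sum_of_nonneg hμ
          · exact hν1 ▸ Finset.sum_le_univ_sum_of_nonneg hν
  have split : ∑ x ∈ A, μ x = ∑ x ∈ A, ∑ y ∈ B, π x y + ∑ x ∈ A, ∑ y ∈ Bᶜ, π x y := by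
    rw [← Finset.sum_add_distrib]
    exact Finset.sum_congr rfl fun x _ => by rw [Finset.sum_add_sum_compl, hrow]
  have close : M * ∑ x ∈ A, μ x < M * ∑ y ∈ B, ν y + 1 := by
    have := (lt_div_iff₀' hM').1 outside
    nlinarith [mul_le_mul_of_nonneg_left inside hM'.le]
  choose k hk using hμint
  choose l hl using hνint
  refine le_of_mul_le_mul_left ?_ hM'
  simp only [Finset.mul_sum, hk, hl] at close ⊢
  exact_mod_cast Nat.lt_succ_iff.1 (by exact_mod_cast close)

/-- A set of vertices closed under the edges of the assignment graph has the same mass in `X` as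
in `Y`. -/
theorem sum_eq_sum_of_assignEdge_closed {X Y : Type*} [Fintype X] [Fintype Y]
    {μ : X → ℝ} {ν : Y → ℝ} (hμ : ∀ x, 0 ≤ μ x) (hν : ∀ y, 0 ≤ ν y)
    (hμ1 : ∑ x, μ x = 1) (hν1 : ∑ y, ν y = 1)
    {π₁ π₂ : X → Y → ℝ}
    (hπ₁pos : ∀ x y, 0 ≤ π₁ x y) (hπ₁row : ∀ x, ∑ y, π₁ x y = μ x)
    (hπ₁col : ∀ y, ∑ x, π₁ x y = ν y)
    (hπ₂pos : ∀ x y, 0 ≤ π₂ x y) (hπ₂row : ∀ x, ∑ y, π₂ x y = μ x)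
    (hπ₂col : ∀ y, ∑ x, π₂ x y = ν y)
    {M : ℕ} (hM : 0 < M)
    (hμint : ∀ x, ∃ k : ℕ, (M : ℝ) * μ x = k) (hνint : ∀ y, ∃ k : ℕ, (M : ℝ) * ν y = k)
    {P : X ⊕ Y → Prop} (hP : ∀ a b, P a → assignEdge π₁ π₂ μ ν M a b → P b) :
    (∑ x, if P (Sum.inl x) then μ x else 0) = ∑ y, if P (Sum.inr y) then ν y else 0 := by
  rw [← Finset.sum_filter, ← Finset.sum_filter]
  apply le_antisymm
  · refine sum_le_sum_of_coupling_lt hμ hν hμ1 hν1 hπ₂pos hπ₂row hπ₂col hM hμint hνint _ _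
      fun x hx y hy => ?_
    simp only [Finset.mem_compl, Finset.mem_filter_univ] at hx hy
    exact not_le.1 fun h => hy (hP (Sum.inl x) (Sum.inr y) hx h)
  · refine sum_le_sum_of_coupling_lt hν hμ hν1 hμ1 (fun y x => hπ₁pos x y) hπ₁col hπ₁row hM
      hνint hμint _ _ fun y hy x hx => ?_
    simp only [Finset.mem_compl, Finset.mem_filter_univ] at hx hy
    rw [mul_comm (ν y)]
    exact not_le.1 fun h => hx (hP (Sum.inr y) (Sum.inl x) hy h)

/-- Under the atomic-mass assumption, mutual reachability in the assignment
graph is an equivalence relation and each strongly connected component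
`X_i ∪ Y_i` satisfies `μ(X_i) = ν(Y_i)` (in particular the `X_i` partition `X`
and the `Y_i` partition `Y`, as equivalence classes). -/
theorem assignment_graph_components_balanced
    {X Y : Type*} [Fintype X] [Fintype Y] [Nonempty X] [Nonempty Y]
    (μ : X → ℝ) (ν : Y → ℝ) (hμ : ∀ x, 0 < μ x) (hν : ∀ y, 0 < ν y)
    (hμ1 : ∑ x, μ x = 1) (hν1 : ∑ y, ν y = 1)
    (π₁ π₂ : X → Y → ℝ)
    (hπ₁pos : ∀ x y, 0 ≤ π₁ x y) (hπ₁row : ∀ x, ∑ y, π₁ x y = μ x)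
    (hπ₁col : ∀ y, ∑ x, π₁ x y = ν y)
    (hπ₂pos : ∀ x y, 0 ≤ π₂ x y) (hπ₂row : ∀ x, ∑ y, π₂ x y = μ x)
    (hπ₂col : ∀ y, ∑ x, π₂ x y = ν y)
    (M : ℕ) (hM : 0 < M)
    (hμint : ∀ x, ∃ k : ℕ, 0 < k ∧ (M : ℝ) * μ x = (k : ℝ))
    (hνint : ∀ y, ∃ k : ℕ, 0 < k ∧ (M : ℝ) * ν y = (k : ℝ))
    (mrel : X ⊕ Y → X ⊕ Y → Prop)
    (hmutual : ∀ a b, mrel a b ↔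
      (Relation.ReflTransGen (assignEdge π₁ π₂ μ ν (M : ℝ)) a b ∧
       Relation.ReflTransGen (assignEdge π₁ π₂ μ ν (M : ℝ)) b a)) :
    Equivalence mrel ∧
    ∀ a : X ⊕ Y,
      (∑ x, if mrel (Sum.inl x) a then μ x else 0) =
      (∑ y, if mrel (Sum.inr y) a then ν y else 0) := by
  refine ⟨⟨fun a => (hmutual a a).2 ⟨.refl, .refl⟩,
    fun h => (hmutual _ _).2 ((hmutual _ _).1 h).symm, fun hab hbc => ?_⟩, fun a => ?_⟩
  · rw [hmutual] at *
    exact ⟨hab.1.trans hbc.1, hbc.2.trans hab.2⟩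
  have balanced {P : X ⊕ Y → Prop}
      (hP : ∀ a b, P a → assignEdge π₁ π₂ μ ν (M : ℝ) a b → P b) :=
    sum_eq_sum_of_assignEdge_closed (fun x => (hμ x).le) (fun y => (hν y).le) hμ1 hν1
      hπ₁pos hπ₁row hπ₁col hπ₂pos hπ₂row hπ₂col hM
      (fun x => (hμint x).imp fun _ => And.right) (fun y => (hνint y).imp fun _ => And.right) hP
  -- The component of `a` is the difference of two closed sets: the vertices reachable from `a`,
  -- and those among them from which `a` is not reachable.
  let R := Relation.ReflTransGen (assignEdge π₁ π₂ μ ν (M : ℝ))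
  have reachable := balanced (P := fun b => R a b) fun b c hb hbc => hb.tail hbc
  have escaped := balanced (P := fun b => R a b ∧ ¬ R b a)
    fun b c hb hbc => ⟨hb.1.tail hbc, fun hc => hb.2 (hc.head hbc)⟩
  have decomp (b : X ⊕ Y) (t : ℝ) : (if mrel b a then t else 0) =
      (if R a b then t else 0) - (if R a b ∧ ¬ R b a then t else 0) := by
    have hb : mrel b a ↔ R b a ∧ R a b := hmutual b a
    by_cases h₁ : R a b <;> by_cases h₂ : R b a <;> simp [hb, h₁, h₂]
  simp only [decomp, Finset.sum_sub_distrib]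
  convert congrArg₂ (· - ·) reachable escaped
end

section
/- Reduction to an effective diagonal problem: let (α†,β†) be a maximizer of J_ε over all α : X → ℝ, β : Y → ℝ. Let {X_i}_{i=1}^R and {Y_i}_{i=1}^R be partitions of X and Y with Σ_{x∈X_i} μ(x) = Σ_{y∈Y_i} ν(y) for every i, and choose representatives y_i ∈ Y_i. Define d(i,j) := −ε·log( Σ_{x∈X_i, y∈Y_j} exp(−(c(x,y) − α†(x) − β†(y_i) − β†(y) + β†(y_j))/ε)·μ(x)·ν(y) ) and Ĵ(β̂) := −ε·Σ_{i,j=1}^R exp(−(d(i,j) + β̂(i) − β̂(j))/ε) for β̂ : {1,…,R} → ℝ. Then β̂† defined by β̂†(i) := β†(y_i) is a maximizer of Ĵ over ℝ^R, and conversely every maximizer of Ĵ equals β̂† plus a constant (i.e. if β̂†† maximizes Ĵ then there is b ∈ ℝ with β̂††(i) = β̂†(i) + b for all i). -/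
/-- A maximizer in the first potential of the entropic dual satisfies the marginal constraint. -/
lemma marginal_of_forall_le {X Y : Type*} [Fintype X] [Fintype Y] [Nonempty Y]
    {μ : X → ℝ} {ν : Y → ℝ} (hμ : ∀ x, 0 < μ x) (hν : ∀ y, 0 < ν y)
    {c : X → Y → ℝ} {ε : ℝ} (hε : 0 < ε) {α : X → ℝ} {β : Y → ℝ}
    (h : ∀ α' : X → ℝ,
      ∑ x, α' x * μ x - ε * ∑ x, ∑ y, μ x * ν y * Real.exp ((α' x + β y - c x y) / ε) ≤
      ∑ x, α x * μ x - ε * ∑ x, ∑ y, μ x * ν y * Real.exp ((α x + β y - c x y) / ε)) (x : X) :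
    ∑ y, ν y * Real.exp ((α x + β y - c x y) / ε) = 1 := by
  set A : X → ℝ := fun x => ∑ y, ν y * Real.exp ((α x + β y - c x y) / ε) with hA
  have hApos : ∀ x, 0 < A x := fun x =>
    Finset.sum_pos (fun y _ => mul_pos (hν y) (Real.exp_pos _)) Finset.univ_nonempty
  have hsum : ∀ x, ∑ y, μ x * ν y * Real.exp ((α x + β y - c x y) / ε) = μ x * A x := fun x => by
    simp only [hA, Finset.mul_sum, mul_assoc]
  have hsum' : ∀ x, ∑ y, μ x * ν y *
      Real.exp ((α x - ε * Real.log (A x) + β y - c x y) / ε) = μ x := fun x => by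
    have : ∀ y, μ x * ν y * Real.exp ((α x - ε * Real.log (A x) + β y - c x y) / ε) =
        μ x / A x * (ν y * Real.exp ((α x + β y - c x y) / ε)) := fun y => by
      rw [show (α x - ε * Real.log (A x) + β y - c x y) / ε =
        (α x + β y - c x y) / ε - Real.log (A x) by field_simp; ring, Real.exp_sub,
        Real.exp_log (hApos x)]
      ring
    simp only [this]
    rw [← Finset.mul_sum]
    exact div_mul_cancel₀ _ (hApos x).ne'
  have key := h fun x => α x - ε * Real.log (A x)
  simp only [hsum, hsum', sub_mul, Finset.sum_sub_distrib] at key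
  have hnonneg : ∀ x ∈ Finset.univ, 0 ≤ μ x * (A x - 1 - Real.log (A x)) := fun x _ =>
    mul_nonneg (hμ x).le (by linarith [Real.log_le_sub_one_of_pos (hApos x)])
  have hle : ∑ x, μ x * (A x - 1 - Real.log (A x)) ≤ 0 := by
    have e : ε * ∑ x, μ x * (A x - 1 - Real.log (A x)) =
        ε * ∑ x, μ x * A x - ε * ∑ x, μ x - ∑ x, ε * Real.log (A x) * μ x := by
      simp only [Finset.mul_sum, ← Finset.sum_sub_distrib]
      exact Finset.sum_congr rfl fun x _ => by ring
    by_contra! hpos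
    have := mul_pos hε hpos
    linarith
  have hz := (Finset.sum_eq_zero_iff_of_nonneg hnonneg).1
    (le_antisymm hle (Finset.sum_nonneg hnonneg)) x (Finset.mem_univ x)
  by_contra hne
  have hlt := Real.log_lt_sub_one_of_pos (hApos x) hne
  have := mul_pos (hμ x) (show 0 < A x - 1 - Real.log (A x) by linarith)
  linarith

lemma sum_sum_of_partition {ι Y : Type*} [Fintype ι] [Fintype Y] {Q : ι → Finset Y}
    (hdisj : ∀ i j, i ≠ j → Disjoint (Q i) (Q j)) (hcover : ∀ y, ∃ i, y ∈ Q i) (f : Y → ℝ) :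
    ∑ i, ∑ y ∈ Q i, f y = ∑ y, f y := by
  classical
  rw [← Finset.sum_biUnion fun i _ j _ hij => hdisj i j hij]
  congr 1
  ext y
  simpa using hcover y

/-- For a positive matrix with equal row and column sums, rescaling by `exp (v i - v j)` does not
decrease the total mass, and preserves it only if `v` is constant. -/
lemma sum_le_sum_mul_exp_sub {ι : Type*} [Fintype ι] {W : ι → ι → ℝ} {m : ι → ℝ}
    (hW : ∀ i j, 0 < W i j) (hrow : ∀ i, ∑ j, W i j = m i) (hcol : ∀ j, ∑ i, W i j = m j)
    (v : ι → ℝ) :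
    ∑ i, ∑ j, W i j ≤ ∑ i, ∑ j, W i j * Real.exp (v i - v j) ∧
    (∑ i, ∑ j, W i j * Real.exp (v i - v j) ≤ ∑ i, ∑ j, W i j → ∀ i j, v i = v j) := by
  have hlin : ∑ i, ∑ j, W i j * (v i - v j) = 0 := by
    simp only [mul_sub, Finset.sum_sub_distrib]
    rw [Finset.sum_comm (f := fun i j => W i j * v j)]
    simp only [← Finset.sum_mul, hrow, hcol, sub_self]
  have hpt : ∀ i j, 0 ≤ W i j * (Real.exp (v i - v j) - 1 - (v i - v j)) := fun i j =>
    mul_nonneg (hW i j).le (by linarith [Real.add_one_le_exp (v i - v j)])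
  have hsum : ∑ i, ∑ j, W i j * (Real.exp (v i - v j) - 1 - (v i - v j)) =
      ∑ i, ∑ j, W i j * Real.exp (v i - v j) - ∑ i, ∑ j, W i j := by
    rw [← sub_zero (_ - _), ← hlin]
    simp only [← Finset.sum_sub_distrib]
    exact Finset.sum_congr rfl fun i _ => Finset.sum_congr rfl fun j _ => by ring
  have hnonneg : ∀ i ∈ Finset.univ,
      0 ≤ ∑ j, W i j * (Real.exp (v i - v j) - 1 - (v i - v j)) := fun i _ =>
    Finset.sum_nonneg fun j _ => hpt i j
  refine ⟨by linarith [Finset.sum_nonneg hnonneg], fun hle i j => ?_⟩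
  have hi := (Finset.sum_eq_zero_iff_of_nonneg hnonneg).1
    (le_antisymm (by linarith) (Finset.sum_nonneg hnonneg)) i (Finset.mem_univ i)
  have hij := (Finset.sum_eq_zero_iff_of_nonneg fun j _ => hpt i j).1 hi j (Finset.mem_univ j)
  by_contra hne
  have hlt := Real.add_one_lt_exp (sub_ne_zero.2 hne)
  have := mul_pos (hW i j) (show 0 < Real.exp (v i - v j) - 1 - (v i - v j) by linarith)
  linarith


/-- Reduction of entropic optimal transport to an effective diagonal problem. -/
theorem effective_diagonal_reduction
    {X Y : Type*} [Fintype X] [Fintype Y] [Nonempty X] [Nonempty Y]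
    (μ : X → ℝ) (ν : Y → ℝ) (hμ : ∀ x, 0 < μ x) (hν : ∀ y, 0 < ν y)
    (hμ1 : ∑ x, μ x = 1) (hν1 : ∑ y, ν y = 1)
    (c : X → Y → ℝ) (ε : ℝ) (hε : 0 < ε)
    (J : (X → ℝ) → (Y → ℝ) → ℝ)
    (hJ : ∀ α β, J α β = ∑ x, α x * μ x + ∑ y, β y * ν y -
      ε * ∑ x, ∑ y, μ x * ν y *
        (Real.exp ((α x + β y - c x y) / ε) - Real.exp (-(c x y) / ε)))
    (αd : X → ℝ) (βd : Y → ℝ)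
    (hopt : ∀ (α : X → ℝ) (β : Y → ℝ), J α β ≤ J αd βd)
    (R : ℕ) (hR : 0 < R)
    (P : Fin R → Finset X) (Q : Fin R → Finset Y)
    (hPdisj : ∀ i j, i ≠ j → Disjoint (P i) (P j))
    (hPcover : ∀ x, ∃ i, x ∈ P i)
    (hQdisj : ∀ i j, i ≠ j → Disjoint (Q i) (Q j))
    (hQcover : ∀ y, ∃ i, y ∈ Q i)
    (hmass : ∀ i, ∑ x ∈ P i, μ x = ∑ y ∈ Q i, ν y)
    (yrep : Fin R → Y) (hyrep : ∀ i, yrep i ∈ Q i)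
    (d : Fin R → Fin R → ℝ)
    (hd : ∀ i j, d i j = -ε * Real.log (∑ x ∈ P i, ∑ y ∈ Q j,
      Real.exp (-(c x y - αd x - βd (yrep i) - βd y + βd (yrep j)) / ε) * μ x * ν y))
    (Jhat : (Fin R → ℝ) → ℝ)
    (hJhat : ∀ b, Jhat b = -ε * ∑ i, ∑ j, Real.exp (-(d i j + b i - b j) / ε)) :
    (∀ b : Fin R → ℝ, Jhat b ≤ Jhat (fun i => βd (yrep i))) ∧
    (∀ b' : Fin R → ℝ, (∀ b, Jhat b ≤ Jhat b') →
      ∃ t : ℝ, ∀ i, b' i = βd (yrep i) + t) := by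
  have hJ' : ∀ α β, J α β = ∑ x, α x * μ x + ∑ y, β y * ν y -
      ε * ∑ x, ∑ y, μ x * ν y * Real.exp ((α x + β y - c x y) / ε) +
      ε * ∑ x, ∑ y, μ x * ν y * Real.exp (-(c x y) / ε) := fun α β => by
    rw [hJ]
    simp only [mul_sub, Finset.sum_sub_distrib]
    ring
  have hX : ∀ x, ∑ y, ν y * Real.exp ((αd x + βd y - c x y) / ε) = 1 :=
    marginal_of_forall_le hμ hν hε fun α' => by
      have := hopt α' βd
      rw [hJ', hJ'] at this
      linarith
  have hY : ∀ y, ∑ x, μ x * Real.exp ((βd y + αd x - c x y) / ε) = 1 :=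
    marginal_of_forall_le (c := fun y x => c x y) hν hμ hε fun β' => by
      have := hopt αd β'
      rw [hJ', hJ', Finset.sum_comm (f := fun x y => μ x * ν y * Real.exp ((_ + β' y - _) / ε)),
        Finset.sum_comm (f := fun x y => μ x * ν y * Real.exp ((_ + βd y - _) / ε))] at this
      simp only [mul_comm (ν _) (μ _), add_comm (β' _) (αd _), add_comm (βd _) (αd _)]
      linarith
  set W : Fin R → Fin R → ℝ := fun i j => ∑ x ∈ P i, ∑ y ∈ Q j,
    μ x * ν y * Real.exp ((αd x + βd y - c x y) / ε) with hWdef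
  have hPne : ∀ i, (P i).Nonempty := fun i => by
    by_contra hempty
    have hi := hmass i
    rw [Finset.not_nonempty_iff_eq_empty.1 hempty, Finset.sum_empty] at hi
    exact (Finset.sum_pos (fun y _ => hν y) ⟨_, hyrep i⟩).ne hi
  have hWpos : ∀ i j, 0 < W i j := fun i j =>
    Finset.sum_pos (fun x _ => Finset.sum_pos
      (fun y _ => mul_pos (mul_pos (hμ x) (hν y)) (Real.exp_pos _)) ⟨_, hyrep j⟩) (hPne i)
  have hrow : ∀ i, ∑ j, W i j = ∑ x ∈ P i, μ x := fun i => by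
    simp only [hWdef]
    rw [Finset.sum_comm]
    refine Finset.sum_congr rfl fun x _ => ?_
    rw [sum_sum_of_partition hQdisj hQcover]
    simp only [mul_assoc]
    rw [← Finset.mul_sum, hX, mul_one]
  have hcol : ∀ j, ∑ i, W i j = ∑ x ∈ P j, μ x := fun j => by
    simp only [hWdef]
    rw [sum_sum_of_partition hPdisj hPcover, Finset.sum_comm, hmass]
    refine Finset.sum_congr rfl fun y _ => ?_
    simp only [mul_comm (μ _) (ν _), mul_assoc, add_comm (αd _) (βd _)]
    rw [← Finset.mul_sum, hY, mul_one]
  have hd' : ∀ i j, d i j = -ε * Real.log (W i j) - βd (yrep i) + βd (yrep j) := fun i j => by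
    have hfac : ∑ x ∈ P i, ∑ y ∈ Q j,
        Real.exp (-(c x y - αd x - βd (yrep i) - βd y + βd (yrep j)) / ε) * μ x * ν y =
        W i j * Real.exp ((βd (yrep i) - βd (yrep j)) / ε) := by
      simp only [hWdef, Finset.sum_mul]
      refine Finset.sum_congr rfl fun x _ => Finset.sum_congr rfl fun y _ => ?_
      rw [mul_assoc (μ x * ν y), ← Real.exp_add, ← add_div, mul_assoc, mul_comm]
      congr 3
      ring
    rw [hd, hfac, Real.log_mul (hWpos i j).ne' (Real.exp_pos _).ne', Real.log_exp]
    field_simp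
    ring
  have hJhat' : ∀ b, Jhat b = -ε * ∑ i, ∑ j, W i j *
      Real.exp ((βd (yrep i) - b i) / ε - (βd (yrep j) - b j) / ε) := fun b => by
    rw [hJhat]
    congr 1
    refine Finset.sum_congr rfl fun i _ => Finset.sum_congr rfl fun j _ => ?_
    rw [hd', show -(-ε * Real.log (W i j) - βd (yrep i) + βd (yrep j) + b i - b j) / ε =
      Real.log (W i j) + ((βd (yrep i) - b i) / ε - (βd (yrep j) - b j) / ε) by field_simp; ring,
      Real.exp_add, Real.exp_log (hWpos i j)]
  have hmax : Jhat (fun i => βd (yrep i)) = -ε * ∑ i, ∑ j, W i j := by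
    simp [hJhat']
  refine ⟨fun b => ?_, fun b' hb' => ?_⟩
  · rw [hmax, hJhat']
    exact mul_le_mul_of_nonpos_left
      (sum_le_sum_mul_exp_sub hWpos hrow hcol fun i => (βd (yrep i) - b i) / ε).1 (by linarith)
  · have hle := hb' fun i => βd (yrep i)
    rw [hmax, hJhat'] at hle
    have hconst := (sum_le_sum_mul_exp_sub hWpos hrow hcol
      fun i => (βd (yrep i) - b' i) / ε).2 (le_of_mul_le_mul_left (by linarith) hε)
    refine ⟨b' ⟨0, hR⟩ - βd (yrep ⟨0, hR⟩), fun i => ?_⟩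
    have := (div_left_inj' hε.ne').1 (hconst i ⟨0, hR⟩)
    linarith
end

section
/- Effective diagonal problem and stability: for every ε > 0 and every d : {1,…,R}² → ℝ, the functional Ĵ_{ε,d} attains its minimum on ℝ^R. Moreover, let ε₁ > ε₂ > 0, let d₁, d₂ : {1,…,R}² → ℝ, let β₁† be a minimizer of Ĵ_{ε₁,d₁} and β₂† a minimizer of Ĵ_{ε₂,d₂}, and set Δβ := β₂† − β₁†, Δd := d₂ − d₁ and w(i,j) := max{−Δd(i,j), Δd(j,i)}. Then max Δβ − min Δβ ≤ maxdiam(w) + 2·ε₁·R·log R. -/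
/-- The effective diagonal functional
`Ĵ_{ε,d}(β) = Σ_{i,j} exp((−d(i,j) − β(i) + β(j))/ε)`. -/
noncomputable def Jdiag {R : ℕ} (ε : ℝ) (d : Fin R → Fin R → ℝ) (β : Fin R → ℝ) : ℝ :=
  ∑ i, ∑ j, Real.exp ((-d i j - β i + β j) / ε)

/-- `maxdiam w`: the length of the longest cycle-free path in `{1,…,R}` with
edge lengths `w`, i.e. the maximum of `Σ_{i=1}^{k−1} w(j_i, j_{i+1})` over all
tuples of at least two pairwise distinct indices. -/
noncomputable def maxdiam {R : ℕ} (w : Fin R → Fin R → ℝ) : ℝ :=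
  sSup {s : ℝ | ∃ l : List (Fin R), l.Nodup ∧ 2 ≤ l.length ∧
    s = ((l.zip l.tail).map fun p => w p.1 p.2).sum}

theorem exp_le_Jdiag {R : ℕ} (ε : ℝ) (d : Fin R → Fin R → ℝ) (β : Fin R → ℝ) (i j : Fin R) :
    Real.exp ((-d i j - β i + β j) / ε) ≤ Jdiag ε d β := by
  unfold Jdiag
  calc Real.exp ((-d i j - β i + β j) / ε)
      ≤ ∑ j, Real.exp ((-d i j - β i + β j) / ε) :=
        Finset.single_le_sum (f := fun j => Real.exp ((-d i j - β i + β j) / ε))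
          (fun _ _ => (Real.exp_pos _).le) (Finset.mem_univ j)
    _ ≤ _ := Finset.single_le_sum (f := fun i => ∑ j, Real.exp ((-d i j - β i + β j) / ε))
          (fun _ _ => Finset.sum_nonneg fun _ _ => (Real.exp_pos _).le) (Finset.mem_univ i)

theorem Jdiag_sub_const {R : ℕ} (ε : ℝ) (d : Fin R → Fin R → ℝ) (β : Fin R → ℝ) (c : ℝ) :
    Jdiag ε d (fun i => β i - c) = Jdiag ε d β := by
  unfold Jdiag
  refine Finset.sum_congr rfl fun i _ => Finset.sum_congr rfl fun j _ => ?_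
  congr 2
  ring

theorem continuous_Jdiag {R : ℕ} (ε : ℝ) (d : Fin R → Fin R → ℝ) : Continuous (Jdiag ε d) := by
  unfold Jdiag
  fun_prop

theorem exists_minimizer_Jdiag {R : ℕ} (hR : 0 < R) {ε : ℝ} (hε : 0 < ε)
    (d : Fin R → Fin R → ℝ) : ∃ βs : Fin R → ℝ, ∀ β, Jdiag ε d βs ≤ Jdiag ε d β := by
  let o : Fin R := ⟨0, hR⟩
  have hJ : 0 < Jdiag ε d 0 := (Real.exp_pos _).trans_le (exp_le_Jdiag ε d 0 o o)
  set M : ℝ := ∑ i, ∑ j, |d i j| + ε * |Real.log (Jdiag ε d 0)|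
  have hd (i j : Fin R) : d i j ≤ ∑ i, ∑ j, |d i j| :=
    (le_abs_self _).trans <| (Finset.single_le_sum (f := fun j => |d i j|)
      (fun _ _ => abs_nonneg _) (Finset.mem_univ j)).trans <|
      Finset.single_le_sum (f := fun i => ∑ j, |d i j|)
        (fun _ _ => Finset.sum_nonneg fun _ _ => abs_nonneg _) (Finset.mem_univ i)
  have hM0 : 0 ≤ M := by positivity
  have key (β : Fin R → ℝ) (i j : Fin R) (h : M < -β i + β j) : Jdiag ε d 0 ≤ Jdiag ε d β := by
    refine le_trans ?_ (exp_le_Jdiag ε d β i j)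
    rw [← Real.log_le_iff_le_exp hJ, le_div_iff₀ hε]
    have h₁ := mul_le_mul_of_nonneg_left (le_abs_self (Real.log (Jdiag ε d 0))) hε.le
    linarith [hd i j]
  obtain ⟨βs, -, hβs⟩ := (isCompact_Icc (a := fun _ : Fin R => -M) (b := fun _ => M)).exists_isMinOn
    ⟨0, fun _ => by simpa using hM0, fun _ => by simpa using hM0⟩ (continuous_Jdiag ε d).continuousOn
  refine ⟨βs, fun β => ?_⟩
  have h0 : Jdiag ε d βs ≤ Jdiag ε d 0 :=
    hβs ⟨fun _ => by simpa using hM0, fun _ => by simpa using hM0⟩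
  by_cases hlo : ∃ i, M < -β i + β o
  · obtain ⟨i, hi⟩ := hlo
    exact h0.trans (key β i o hi)
  by_cases hhi : ∃ i, M < -β o + β i
  · obtain ⟨i, hi⟩ := hhi
    exact h0.trans (key β o i hi)
  push Not at hlo hhi
  rw [← Jdiag_sub_const ε d β (β o)]
  exact hβs ⟨fun i => by linarith [hlo i], fun i => by linarith [hhi i]⟩

/-- At a minimizer the exponential weights form a circulation: the flow out of any set of vertices
equals the flow into it. -/
theorem cut_balance_of_minimizer {R : ℕ} {ε : ℝ} (hε : 0 < ε) {d : Fin R → Fin R → ℝ}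
    {β : Fin R → ℝ} (hβ : ∀ β', Jdiag ε d β ≤ Jdiag ε d β') (S : Finset (Fin R)) :
    ∑ x ∈ S ×ˢ Sᶜ, Real.exp ((-d x.1 x.2 - β x.1 + β x.2) / ε) =
      ∑ x ∈ S ×ˢ Sᶜ, Real.exp ((-d x.2 x.1 - β x.2 + β x.1) / ε) := by
  set a : Fin R → Fin R → ℝ := fun i j => Real.exp ((-d i j - β i + β j) / ε) with ha
  set s : Fin R → ℝ := fun i => if i ∈ S then 1 else 0 with hs
  have hder : HasDerivAt (fun t : ℝ => Jdiag ε d (fun i => β i + t * s i))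
      (∑ i, ∑ j, a i j * ((-s i + s j) / ε)) 0 := by
    unfold Jdiag
    refine HasDerivAt.fun_sum fun i _ => HasDerivAt.fun_sum fun j _ => ?_
    have hlin : HasDerivAt (fun t : ℝ => (-d i j - (β i + t * s i) + (β j + t * s j)) / ε)
        ((-s i + s j) / ε) 0 := by
      have h := (((((hasDerivAt_id (0 : ℝ)).mul_const (s i)).const_add (β i)).const_sub
        (-d i j)).add (((hasDerivAt_id (0 : ℝ)).mul_const (s j)).const_add (β j))).div_const ε
      simpa using h
    simpa [ha] using hlin.exp
  have hmin : IsLocalMin (fun t : ℝ => Jdiag ε d (fun i => β i + t * s i)) 0 :=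
    Filter.Eventually.of_forall fun t => by simpa using hβ _
  have hzero := hmin.hasDerivAt_eq_zero hder
  have hsplit (f : Fin R → Fin R → ℝ) :
      ∑ x ∈ S ×ˢ Sᶜ, f x.1 x.2 = ∑ i, ∑ j, f i j * (s i * (1 - s j)) := by
    have hc : S ×ˢ Sᶜ = Finset.univ.filter fun x : Fin R × Fin R => x.1 ∈ S ∧ x.2 ∉ S := by
      ext x
      simp
    rw [hc, Finset.sum_filter, ← Finset.univ_product_univ, Finset.sum_product]
    refine Finset.sum_congr rfl fun i _ => Finset.sum_congr rfl fun j _ => ?_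
    by_cases hi : i ∈ S <;> by_cases hj : j ∈ S <;> simp [hs, hi, hj]
  have h₁ := hsplit a
  have h₂ := hsplit fun i j => a j i
  rw [Finset.sum_comm] at h₂
  have hdiff : (∑ i, ∑ j, a i j * (s j * (1 - s i))) - ∑ i, ∑ j, a i j * (s i * (1 - s j)) =
      ε * ∑ i, ∑ j, a i j * ((-s i + s j) / ε) := by
    simp only [← Finset.sum_sub_distrib, Finset.mul_sum]
    refine Finset.sum_congr rfl fun i _ => Finset.sum_congr rfl fun j _ => ?_
    field_simp
    ring
  rw [hzero, mul_zero] at hdiff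
  simp only [ha] at h₁ h₂ hdiff
  linarith

theorem exists_log_sum_le {ι : Type*} {s : Finset ι} (hs : s.Nonempty) {f : ι → ℝ}
    (hf : ∀ x, 0 < f x) :
    ∃ x ∈ s, Real.log (∑ y ∈ s, f y) ≤ Real.log s.card + Real.log (f x) := by
  obtain ⟨x, hx, hmax⟩ := s.exists_max_image f hs
  refine ⟨x, hx, ?_⟩
  have hcard : (s.card : ℝ) ≠ 0 := by exact_mod_cast hs.card_pos.ne'
  rw [← Real.log_mul hcard (hf x).ne']
  refine Real.log_le_log (Finset.sum_pos (fun y _ => hf y) hs) ?_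
  simpa using Finset.sum_le_card_nsmul s f (f x) hmax

theorem log_le_log_sum {ι : Type*} {s : Finset ι} {f : ι → ℝ} (hf : ∀ x, 0 < f x) {x : ι}
    (hx : x ∈ s) : Real.log (f x) ≤ Real.log (∑ y ∈ s, f y) :=
  Real.log_le_log (hf x) (Finset.single_le_sum (fun y _ => (hf y).le) hx)

/-- Across every cut there is an edge along which the difference of two minimizers is controlled. -/
theorem exists_cut_edge_le {R : ℕ} {ε₁ ε₂ : ℝ} {d₁ d₂ : Fin R → Fin R → ℝ} {β₁ β₂ : Fin R → ℝ}
    (hε₂ : 0 < ε₂) (hε : ε₂ ≤ ε₁) (h₁ : ∀ β, Jdiag ε₁ d₁ β₁ ≤ Jdiag ε₁ d₁ β)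
    (h₂ : ∀ β, Jdiag ε₂ d₂ β₂ ≤ Jdiag ε₂ d₂ β) {S : Finset (Fin R)} (hS : S.Nonempty)
    (hS' : Sᶜ.Nonempty) :
    ∃ i ∈ S, ∃ j ∉ S, (β₂ i - β₁ i) - (β₂ j - β₁ j) ≤
      max (-(d₂ i j - d₁ i j)) (d₂ j i - d₁ j i) + 2 * ε₁ * Real.log R := by
  have hε₁ : 0 < ε₁ := hε₂.trans_le hε
  have hne : (S ×ˢ Sᶜ).Nonempty := hS.product hS'
  have b₁ := cut_balance_of_minimizer hε₁ h₁ S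
  have b₂ := cut_balance_of_minimizer hε₂ h₂ S
  obtain ⟨x, hx, hx₂⟩ := exists_log_sum_le hne
    (f := fun x => Real.exp ((-d₂ x.1 x.2 - β₂ x.1 + β₂ x.2) / ε₂)) fun _ => Real.exp_pos _
  obtain ⟨y, hy, hy₁⟩ := exists_log_sum_le hne
    (f := fun x => Real.exp ((-d₁ x.2 x.1 - β₁ x.2 + β₁ x.1) / ε₁)) fun _ => Real.exp_pos _
  have hx₁ := log_le_log_sum (f := fun x : Fin R × Fin R =>
    Real.exp ((-d₁ x.1 x.2 - β₁ x.1 + β₁ x.2) / ε₁)) (fun _ => Real.exp_pos _) hx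
  have hy₂ := log_le_log_sum (f := fun x : Fin R × Fin R =>
    Real.exp ((-d₂ x.2 x.1 - β₂ x.2 + β₂ x.1) / ε₂)) (fun _ => Real.exp_pos _) hy
  rw [b₁] at hx₁
  rw [← b₂] at hy₂
  simp only [Real.log_exp] at hx₁ hx₂ hy₁ hy₂
  set F₁ := Real.log (∑ x ∈ S ×ˢ Sᶜ, Real.exp ((-d₁ x.2 x.1 - β₁ x.2 + β₁ x.1) / ε₁))
  set F₂ := Real.log (∑ x ∈ S ×ˢ Sᶜ, Real.exp ((-d₂ x.1 x.2 - β₂ x.1 + β₂ x.2) / ε₂))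
  have hcard : Real.log (S ×ˢ Sᶜ).card ≤ 2 * Real.log R := by
    have hle : (S ×ˢ Sᶜ).card ≤ R ^ 2 := by
      simpa [sq] using Finset.card_le_univ (S ×ˢ Sᶜ)
    calc Real.log (S ×ˢ Sᶜ).card ≤ Real.log ((R : ℝ) ^ 2) :=
          Real.log_le_log (by exact_mod_cast hne.card_pos) (by exact_mod_cast hle)
      _ = 2 * Real.log R := by simp
  have hlogR : 0 ≤ Real.log R := Real.log_natCast_nonneg R
  rw [div_le_iff₀ hε₁] at hx₁
  rw [div_le_iff₀ hε₂] at hy₂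
  rw [← sub_le_iff_le_add', le_div_iff₀ hε₂] at hx₂
  rw [← sub_le_iff_le_add', le_div_iff₀ hε₁] at hy₁
  have hc₁ := mul_le_mul_of_nonneg_right hcard hε₁.le
  have hc₂ := mul_le_mul_of_nonneg_right hcard hε₂.le
  have hc₃ := mul_le_mul_of_nonneg_left hε hlogR
  simp only [Finset.mem_product, Finset.mem_compl] at hx hy
  rcases le_total (F₁ * ε₁) (F₂ * ε₂) with h | h
  · refine ⟨x.1, hx.1, x.2, hx.2, ?_⟩
    have := le_max_left (-(d₂ x.1 x.2 - d₁ x.1 x.2)) (d₂ x.2 x.1 - d₁ x.2 x.1)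
    linarith
  · refine ⟨y.1, hy.1, y.2, hy.2, ?_⟩
    have := le_max_right (-(d₂ y.1 y.2 - d₁ y.1 y.2)) (d₂ y.2 y.1 - d₁ y.2 y.1)
    linarith

/-- If a relation crosses every cut, any two points are joined by a simple path. -/
theorem exists_nodup_isChain {α : Type*} [Fintype α] {E : α → α → Prop}
    (hE : ∀ S : Finset α, S.Nonempty → (∃ j, j ∉ S) → ∃ i ∈ S, ∃ j ∉ S, E i j) (p q : α) :
    ∃ l : List α, (p :: l).Nodup ∧ (p :: l).IsChain E ∧ (p :: l).getLast? = some q := by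
  classical
  let P : α → Prop := fun v =>
    ∃ l : List α, (v :: l).Nodup ∧ (v :: l).IsChain E ∧ (v :: l).getLast? = some q
  change P p
  by_contra hp
  have hq : P q := ⟨[], by simp⟩
  obtain ⟨i, hi, j, hj, hij⟩ := hE (Finset.univ.filter fun v => ¬ P v) ⟨p, by simpa using hp⟩
    ⟨q, by simpa using hq⟩
  simp only [Finset.mem_filter, Finset.mem_univ, true_and, not_not] at hi hj
  obtain ⟨l, hnd, hch, hlast⟩ := hj
  refine hi ?_
  by_cases hmem : i ∈ j :: l
  · obtain ⟨l₁, l₂, h⟩ := List.append_of_mem hmem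
    rw [h] at hnd hch hlast
    refine ⟨l₂, hnd.of_append_right, hch.right_of_append, ?_⟩
    simpa using hlast
  · exact ⟨j :: l, List.nodup_cons.2 ⟨hmem, hnd⟩, List.isChain_cons_cons.2 ⟨hij, hch⟩, by
      simpa using hlast⟩

theorem sub_le_path_sum {α : Type*} {f : α → ℝ} {w : α → α → ℝ} {c : ℝ} {q : α} (l : List α) :
    ∀ p, (p :: l).IsChain (fun i j => f i - f j ≤ w i j + c) → (p :: l).getLast? = some q →
      f p - f q ≤ (((p :: l).zip l).map fun x => w x.1 x.2).sum + l.length * c := by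
  induction l with
  | nil =>
    intro p _ h
    simp only [List.getLast?_singleton, Option.some.injEq] at h
    simp [h]
  | cons j l ih =>
    intro p hch hlast
    rw [List.isChain_cons_cons] at hch
    have := ih j hch.2 (by simpa using hlast)
    simp only [List.zip_cons_cons, List.map_cons, List.sum_cons, List.length_cons]
    push_cast
    linarith [hch.1]

theorem path_sum_le_maxdiam {R : ℕ} (w : Fin R → Fin R → ℝ) {l : List (Fin R)} (hl : l.Nodup)
    (hlen : 2 ≤ l.length) : ((l.zip l.tail).map fun x => w x.1 x.2).sum ≤ maxdiam w := by
  refine le_csSup (Set.Finite.bddAbove ?_) ⟨l, hl, hlen, rfl⟩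
  refine (Set.finite_range fun l : {l : List (Fin R) // l.Nodup} =>
    ((l.1.zip l.1.tail).map fun x => w x.1 x.2).sum).subset ?_
  rintro s ⟨l, hl, -, rfl⟩
  exact ⟨⟨l, hl⟩, rfl⟩

/-- The oscillation of a function is bounded by a longest simple path, provided its increments
are controlled across every cut. -/
theorem sub_le_maxdiam_add {R : ℕ} {f : Fin R → ℝ} {w : Fin R → Fin R → ℝ} {c : ℝ} (hc : 0 ≤ c)
    (hcut : ∀ S : Finset (Fin R), S.Nonempty → (∃ j, j ∉ S) →
      ∃ i ∈ S, ∃ j ∉ S, f i - f j ≤ w i j + c) {p q : Fin R} (hpq : p ≠ q) :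
    f p - f q ≤ maxdiam w + R * c := by
  obtain ⟨l, hnd, hch, hlast⟩ := exists_nodup_isChain hcut p q
  have hlen : 2 ≤ (p :: l).length := by
    rcases l with _ | ⟨j, l⟩
    · simp [hpq] at hlast
    · simp
  have hsum := path_sum_le_maxdiam w hnd hlen
  have hle := sub_le_path_sum l p hch hlast
  have hR : l.length ≤ R := by
    have := hnd.length_le_card
    simp only [List.length_cons, Fintype.card_fin] at this
    omega
  have := mul_le_mul_of_nonneg_right (Nat.cast_le (α := ℝ).2 hR) hc
  simp only [List.tail_cons] at hsum
  linarith

/-- Existence of minimizers of the effective diagonal problem and stability of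
its minimizers under change of `ε` and `d`. -/
theorem effective_diagonal_stability {R : ℕ} (hR : 2 ≤ R) :
    (∀ ε : ℝ, 0 < ε → ∀ d : Fin R → Fin R → ℝ,
      ∃ βs : Fin R → ℝ, ∀ β : Fin R → ℝ, Jdiag ε d βs ≤ Jdiag ε d β) ∧
    (∀ (ε₁ ε₂ : ℝ) (d₁ d₂ : Fin R → Fin R → ℝ) (β₁ β₂ : Fin R → ℝ),
      0 < ε₂ → ε₂ < ε₁ →
      (∀ β, Jdiag ε₁ d₁ β₁ ≤ Jdiag ε₁ d₁ β) →
      (∀ β, Jdiag ε₂ d₂ β₂ ≤ Jdiag ε₂ d₂ β) →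
      Finset.univ.sup' ⟨⟨0, by omega⟩, Finset.mem_univ _⟩ (fun i => β₂ i - β₁ i) -
        Finset.univ.inf' ⟨⟨0, by omega⟩, Finset.mem_univ _⟩ (fun i => β₂ i - β₁ i) ≤
      maxdiam (fun i j => max (-(d₂ i j - d₁ i j)) (d₂ j i - d₁ j i)) +
        2 * ε₁ * R * Real.log R) := by
  refine ⟨fun ε hε d => exists_minimizer_Jdiag (by omega) hε d, ?_⟩
  intro ε₁ ε₂ d₁ d₂ β₁ β₂ hε₂ hε h₁ h₂
  set f : Fin R → ℝ := fun i => β₂ i - β₁ i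
  have hosc {p q : Fin R} (hpq : p ≠ q) := sub_le_maxdiam_add (f := f)
    (w := fun i j => max (-(d₂ i j - d₁ i j)) (d₂ j i - d₁ j i)) (c := 2 * ε₁ * Real.log R)
    (mul_nonneg (by linarith) (Real.log_natCast_nonneg R))
    (fun S hS ⟨j, hj⟩ =>
      exists_cut_edge_le hε₂ hε.le h₁ h₂ hS ⟨j, Finset.mem_compl.2 hj⟩) hpq
  have hne : (Finset.univ : Finset (Fin R)).Nonempty := ⟨⟨0, by omega⟩, Finset.mem_univ _⟩
  obtain ⟨p, -, hp⟩ := Finset.exists_mem_eq_sup' hne f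
  obtain ⟨q, -, hq⟩ := Finset.exists_mem_eq_inf' hne f
  rw [hp, hq]
  by_cases hpq : p = q
  · have : Nontrivial (Fin R) := Fin.nontrivial_iff_two_le.2 hR
    obtain ⟨r, hr⟩ := exists_ne p
    have hrp : f q ≤ f r := hq ▸ Finset.inf'_le f (Finset.mem_univ r)
    have := hosc hr
    rw [hpq] at this ⊢
    linarith
  · have := hosc hpq
    linarith
end

section
/- Stability of dual solutions under ε-scaling: assume c(x,y) ≥ 0 for all (x,y), let N be a bound with max{|X|,|Y|} ≤ N < ∞, and assume there exists a positive integer M such that M·μ(x) and M·ν(y) are positive integers for all x ∈ X, y ∈ Y. Let ε₁ > ε₂ > 0, let (α₁,β₁) be a maximizer of J_{ε₁} and (α₂,β₂) a maximizer of J_{ε₂}, and set Δα := α₂ − α₁, Δβ := β₂ − β₁. Then max Δα − min Δα ≤ ε₁·N·(4·log N + 24·log M) and max Δβ − min Δβ ≤ ε₁·N·(4·log N + 24·log M). -/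
/-- If every non-maximal value of a finite real family is followed by another value at distance at
most `g`, then the family has range at most `g` times the number of indices. -/
theorem sub_le_mul_card_of_gap_le {ι : Type*} [Fintype ι] (f : ι → ℝ) (g : ℝ) (hg : 0 ≤ g)
    (h : ∀ i, (∃ j, f i < f j) → ∃ j, f i < f j ∧ f j ≤ f i + g) (i j : ι) :
    f j - f i ≤ g * Fintype.card ι := by
  classical
  have key : ∀ n : ℕ, ∀ i, (Finset.univ.filter fun k => f i < f k).card = n →
      f j - f i ≤ g * n := by
    intro n
    induction n using Nat.strong_induction_on with
    | _ n ih =>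
      intro i hi
      rcases le_or_gt (f j) (f i) with hji | hij
      · have : 0 ≤ g * n := by positivity
        linarith
      · obtain ⟨k, hik, hki⟩ := h i ⟨j, hij⟩
        have hlt : (Finset.univ.filter fun l => f k < f l).card < n := by
          rw [← hi]
          apply Finset.card_lt_card
          rw [Finset.ssubset_iff_of_subset]
          · exact ⟨k, by simpa using hik, by simp⟩
          · intro l hl
            simp only [Finset.mem_filter, Finset.mem_univ, true_and] at hl ⊢
            exact hik.trans hl
        have h1 := ih _ hlt k rfl
        have h2 : ((Finset.univ.filter fun l => f k < f l).card : ℝ) + 1 ≤ n := by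
          exact_mod_cast hlt
        nlinarith
  refine (key _ i rfl).trans (mul_le_mul_of_nonneg_left ?_ hg)
  exact_mod_cast Finset.card_le_univ _

/-- First-order optimality condition for the entropic optimal transport dual, tested against
an arbitrary direction `(h, k)`. -/
theorem entropic_dual_stationary {X Y : Type*} [Fintype X] [Fintype Y]
    (μ : X → ℝ) (ν : Y → ℝ) (c : X → Y → ℝ) (ε : ℝ) (hε : 0 < ε) (J : (X → ℝ) → (Y → ℝ) → ℝ)
    (hJ : ∀ α β, J α β = ∑ x, α x * μ x + ∑ y, β y * ν y -
      ε * ∑ x, ∑ y, μ x * ν y *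
        (Real.exp ((α x + β y - c x y) / ε) - Real.exp (-(c x y) / ε)))
    (α : X → ℝ) (β : Y → ℝ) (hopt : ∀ α' β', J α' β' ≤ J α β) (h : X → ℝ) (k : Y → ℝ) :
    ∑ x, h x * μ x + ∑ y, k y * ν y =
      ∑ x, ∑ y, μ x * ν y * Real.exp ((α x + β y - c x y) / ε) * (h x + k y) := by
  have hd : HasDerivAt (fun s : ℝ => J (fun x => α x + s * h x) (fun y => β y + s * k y))
      (∑ x, h x * μ x + ∑ y, k y * ν y - ε * ∑ x, ∑ y, μ x * ν y *
        (Real.exp ((α x + β y - c x y) / ε) * ((h x + k y) / ε))) 0 := by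
    simp only [hJ]
    have lin : ∀ a b : ℝ, HasDerivAt (fun s : ℝ => a + s * b) b 0 := fun a b => by
      simpa using ((hasDerivAt_id (0 : ℝ)).mul_const b).const_add a
    refine HasDerivAt.sub (HasDerivAt.add ?_ ?_) (HasDerivAt.const_mul ε ?_)
    · exact HasDerivAt.fun_sum fun x _ => (lin (α x) (h x)).mul_const _
    · exact HasDerivAt.fun_sum fun y _ => (lin (β y) (k y)).mul_const _
    · refine HasDerivAt.fun_sum fun x _ => HasDerivAt.fun_sum fun y _ =>
        HasDerivAt.const_mul _ (HasDerivAt.sub_const _ ?_)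
      have := ((((lin (α x) (h x)).add (lin (β y) (k y))).sub_const (c x y)).div_const ε).exp
      simpa using this
  have hmax : IsLocalMax
      (fun s : ℝ => J (fun x => α x + s * h x) (fun y => β y + s * k y)) 0 := by
    refine Filter.Eventually.of_forall fun s => ?_
    simpa using hopt _ _
  have h0 := hmax.hasDerivAt_eq_zero hd
  rw [sub_eq_zero] at h0
  rw [h0, Finset.mul_sum]
  refine Finset.sum_congr rfl fun x _ => ?_
  rw [Finset.mul_sum]
  refine Finset.sum_congr rfl fun y _ => ?_
  field_simp

/-- A subprobability-weighted sum of exponentials with exponents below `t` is below `exp t`. -/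
theorem sum_mul_exp_lt_exp {ι : Type*} (S : Finset ι) (w u : ι → ℝ) (hw : ∀ i ∈ S, 0 < w i)
    (hw1 : ∑ i ∈ S, w i ≤ 1) (t : ℝ) (hu : ∀ i ∈ S, u i < t) :
    ∑ i ∈ S, w i * Real.exp (u i) < Real.exp t := by
  rcases S.eq_empty_or_nonempty with rfl | hS
  · simpa using Real.exp_pos t
  · calc ∑ i ∈ S, w i * Real.exp (u i) < ∑ i ∈ S, w i * Real.exp t :=
          Finset.sum_lt_sum_of_nonempty hS fun i hi =>
            mul_lt_mul_of_pos_left (Real.exp_lt_exp.2 (hu i hi)) (hw i hi)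
      _ = (∑ i ∈ S, w i) * Real.exp t := by rw [Finset.sum_mul]
      _ ≤ Real.exp t := mul_le_of_le_one_left (Real.exp_pos t).le hw1

theorem exists_log_sum_mul_exp_le {ι : Type*} (S : Finset ι) (hS : S.Nonempty) (w u : ι → ℝ)
    (hw : ∀ i ∈ S, 0 < w i) (hw1 : ∑ i ∈ S, w i ≤ 1) :
    ∃ i ∈ S, Real.log (∑ i ∈ S, w i * Real.exp (u i)) ≤ u i := by
  by_contra! hlt
  have := sum_mul_exp_lt_exp S w u hw hw1 _ hlt
  rw [Real.exp_log (Finset.sum_pos (fun i hi => mul_pos (hw i hi) (Real.exp_pos _)) hS)] at this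
  exact lt_irrefl _ this

theorem le_log_sum_mul_exp_add {ι : Type*} (S : Finset ι) (w u : ι → ℝ)
    (hw : ∀ i ∈ S, 0 < w i) (L : ℝ) (i : ι) (hi : i ∈ S) (hL : -L ≤ Real.log (w i)) :
    u i ≤ Real.log (∑ i ∈ S, w i * Real.exp (u i)) + L := by
  have h1 : w i * Real.exp (u i) ≤ ∑ i ∈ S, w i * Real.exp (u i) :=
    Finset.single_le_sum (f := fun i => w i * Real.exp (u i))
      (fun j hj => (mul_pos (hw j hj) (Real.exp_pos _)).le) hi
  have h2 := Real.log_le_log (mul_pos (hw i hi) (Real.exp_pos _)) h1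
  rw [Real.log_mul (hw i hi).ne' (Real.exp_pos _).ne', Real.log_exp] at h2
  linarith

theorem exists_int_mul_sum_eq {ι : Type*} (S : Finset ι) (M : ℕ) (m : ι → ℝ)
    (hm : ∀ i, ∃ k : ℕ, 0 < k ∧ (M : ℝ) * m i = (k : ℝ)) :
    ∃ d : ℤ, (M : ℝ) * ∑ i ∈ S, m i = d := by
  choose k _ hk using hm
  exact ⟨∑ i ∈ S, (k i : ℤ), by
    push_cast
    rw [Finset.mul_sum]
    exact Finset.sum_congr rfl fun i _ => hk i⟩

theorem neg_log_le_log_of_mul_eq_natCast (M : ℕ) (hM : 0 < M) (m : ℝ) (hm : 0 < m)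
    (hint : ∃ k : ℕ, 0 < k ∧ (M : ℝ) * m = (k : ℝ)) : -Real.log M ≤ Real.log m := by
  obtain ⟨k, hk, hkm⟩ := hint
  have h1 : (1 : ℝ) ≤ M * m := by
    rw [hkm]
    exact_mod_cast hk
  have h2 := Real.log_nonneg h1
  rw [Real.log_mul (by exact_mod_cast hM.ne') hm.ne'] at h2
  linarith

/-- The density of a coupling relative to the product of its marginals is bounded by the
inverse of the second marginal. -/
theorem le_neg_log_of_coupling {X Y : Type*} [Fintype X] [Fintype Y]
    (μ : X → ℝ) (ν : Y → ℝ) (hμ : ∀ x, 0 < μ x) (hν : ∀ y, 0 < ν y) (u : X → Y → ℝ)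
    (hu : ∀ (h : X → ℝ) (k : Y → ℝ), ∑ x, h x * μ x + ∑ y, k y * ν y =
      ∑ x, ∑ y, μ x * ν y * Real.exp (u x y) * (h x + k y)) (x : X) (y : Y) :
    u x y ≤ -Real.log (ν y) := by
  classical
  have h1 := hu (fun x' => if x' = x then 1 else 0) 0
  simp only [ite_mul, one_mul, zero_mul, Finset.sum_ite_eq', Finset.mem_univ, if_true,
    Pi.zero_apply, Finset.sum_const_zero, add_zero, mul_ite, mul_one, mul_zero] at h1
  have h2 : μ x = ∑ y, μ x * ν y * Real.exp (u x y) := by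
    refine h1.trans ?_
    rw [Finset.sum_eq_single x]
    · simp
    · intro b _ hb
      simp [hb]
    · simp
  have h3 : μ x * ν y * Real.exp (u x y) ≤ μ x := by
    conv_rhs => rw [h2]
    exact Finset.single_le_sum (f := fun y => μ x * ν y * Real.exp (u x y))
      (fun y _ => (mul_pos (mul_pos (hμ x) (hν y)) (Real.exp_pos _)).le) (Finset.mem_univ y)
  have h4 := Real.log_le_log (mul_pos (mul_pos (hμ x) (hν y)) (Real.exp_pos _)) h3
  rw [Real.log_mul (mul_pos (hμ x) (hν y)).ne' (Real.exp_pos _).ne',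
    Real.log_mul (hμ x).ne' (hν y).ne', Real.log_exp] at h4
  linarith

/-- Mass balance of a coupling across a cut `(A, B)`. -/
theorem sum_sub_sum_eq_of_coupling {X Y : Type*} [Fintype X] [Fintype Y]
    [DecidableEq X] [DecidableEq Y]
    (μ : X → ℝ) (ν : Y → ℝ) (u : X → Y → ℝ)
    (hu : ∀ (h : X → ℝ) (k : Y → ℝ), ∑ x, h x * μ x + ∑ y, k y * ν y =
      ∑ x, ∑ y, μ x * ν y * Real.exp (u x y) * (h x + k y)) (A : Finset X) (B : Finset Y) :
    ∑ x ∈ A, μ x - ∑ y ∈ B, ν y =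
      ∑ p ∈ A ×ˢ Bᶜ, μ p.1 * ν p.2 * Real.exp (u p.1 p.2) -
        ∑ p ∈ Aᶜ ×ˢ B, μ p.1 * ν p.2 * Real.exp (u p.1 p.2) := by
  have h1 := hu (fun x => if x ∈ A then 1 else 0) (fun y => if y ∈ B then -1 else 0)
  have hA : ∑ x, (if x ∈ A then (1 : ℝ) else 0) * μ x = ∑ x ∈ A, μ x := by
    simp [ite_mul]
  have hB : ∑ y, (if y ∈ B then (-1 : ℝ) else 0) * ν y = -∑ y ∈ B, ν y := by
    simp [ite_mul]
  have key : ∀ S : Finset (X × Y), ∑ p ∈ S, μ p.1 * ν p.2 * Real.exp (u p.1 p.2) =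
      ∑ p, if p ∈ S then μ p.1 * ν p.2 * Real.exp (u p.1 p.2) else 0 := fun S => by simp
  rw [hA, hB, ← sub_eq_add_neg] at h1
  rw [h1, key, key, ← Finset.sum_sub_distrib, Fintype.sum_prod_type]
  refine Finset.sum_congr rfl fun x _ => Finset.sum_congr rfl fun y _ => ?_
  by_cases hx : x ∈ A <;> by_cases hy : y ∈ B <;> simp [hx, hy]

/-- Two couplings `μ ν exp u₁` and `μ ν exp u₂` of the same `1 / M`-integral marginals cannot be
separated by more than `2 ε₁ log M` across a nontrivial cut `(A, B)`. -/
theorem not_cut_separated {X Y : Type*} [Fintype X] [Fintype Y]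
    (μ : X → ℝ) (ν : Y → ℝ) (hμ : ∀ x, 0 < μ x) (hν : ∀ y, 0 < ν y)
    (hμ1 : ∑ x, μ x = 1) (hν1 : ∑ y, ν y = 1) (M : ℕ) (hM : 0 < M)
    (hμint : ∀ x, ∃ k : ℕ, 0 < k ∧ (M : ℝ) * μ x = (k : ℝ))
    (hνint : ∀ y, ∃ k : ℕ, 0 < k ∧ (M : ℝ) * ν y = (k : ℝ))
    (ε₁ ε₂ : ℝ) (hε₂ : 0 < ε₂) (hε : ε₂ < ε₁) (u₁ u₂ : X → Y → ℝ)
    (h₁ : ∀ (h : X → ℝ) (k : Y → ℝ), ∑ x, h x * μ x + ∑ y, k y * ν y =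
      ∑ x, ∑ y, μ x * ν y * Real.exp (u₁ x y) * (h x + k y))
    (h₂ : ∀ (h : X → ℝ) (k : Y → ℝ), ∑ x, h x * μ x + ∑ y, k y * ν y =
      ∑ x, ∑ y, μ x * ν y * Real.exp (u₂ x y) * (h x + k y))
    (A : Finset X) (B : Finset Y)
    (hne : A.Nonempty ∨ B.Nonempty) (hne' : (∃ x, x ∉ A) ∨ (∃ y, y ∉ B))
    (hup : ∀ x ∈ A, ∀ y ∉ B, 2 * ε₁ * Real.log M < ε₂ * u₂ x y - ε₁ * u₁ x y)
    (hdown : ∀ x ∉ A, ∀ y ∈ B, ε₂ * u₂ x y - ε₁ * u₁ x y < -(2 * ε₁ * Real.log M)) :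
    False := by
  classical
  have hMR : (0 : ℝ) < M := by exact_mod_cast hM
  set L := Real.log M with hLdef
  have hL : 0 ≤ L := Real.log_natCast_nonneg M
  have hε₁ : 0 < ε₁ := hε₂.trans hε
  have hexpL : Real.exp (-L) = 1 / M := by
    rw [Real.exp_neg, hLdef, Real.exp_log hMR, one_div]
  have atomμ := fun x => neg_log_le_log_of_mul_eq_natCast M hM (μ x) (hμ x) (hμint x)
  have atomν := fun y => neg_log_le_log_of_mul_eq_natCast M hM (ν y) (hν y) (hνint y)
  have le₁ : ∀ x y, u₁ x y ≤ L := fun x y => by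
    linarith [le_neg_log_of_coupling μ ν hμ hν u₁ h₁ x y, atomν y]
  have le₂ : ∀ x y, u₂ x y ≤ L := fun x y => by
    linarith [le_neg_log_of_coupling μ ν hμ hν u₂ h₂ x y, atomν y]
  have hw : ∀ p : X × Y, 0 < μ p.1 * ν p.2 := fun p => mul_pos (hμ _) (hν _)
  have hw1 : ∀ S : Finset (X × Y), ∑ p ∈ S, μ p.1 * ν p.2 ≤ 1 := by
    intro S
    calc ∑ p ∈ S, μ p.1 * ν p.2 ≤ ∑ p : X × Y, μ p.1 * ν p.2 :=
          Finset.sum_le_univ_sum_of_nonneg fun p => (hw p).le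
      _ = 1 := by
        rw [Fintype.sum_prod_type]
        simp [← Finset.mul_sum, hμ1, hν1]
  have hwL : ∀ p : X × Y, -(2 * L) ≤ Real.log (μ p.1 * ν p.2) := fun p => by
    rw [Real.log_mul (hμ _).ne' (hν _).ne']
    linarith [atomμ p.1, atomν p.2]
  have bal₁ := sum_sub_sum_eq_of_coupling μ ν u₁ h₁ A B
  have bal₂ := sum_sub_sum_eq_of_coupling μ ν u₂ h₂ A B
  have nonneg : ∀ (S : Finset (X × Y)) (u : X → Y → ℝ),
      0 ≤ ∑ p ∈ S, μ p.1 * ν p.2 * Real.exp (u p.1 p.2) := fun S u =>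
    Finset.sum_nonneg fun p _ => (mul_pos (hw p) (Real.exp_pos _)).le
  have small₁ := sum_mul_exp_lt_exp (A ×ˢ Bᶜ) (fun p => μ p.1 * ν p.2) (fun p => u₁ p.1 p.2)
    (fun p _ => hw p) (hw1 _) (-L) (by
      intro p hp
      rw [Finset.mem_product, Finset.mem_compl] at hp
      have := hup p.1 hp.1 p.2 hp.2
      by_contra! hcon
      nlinarith [mul_le_mul_of_nonneg_left (le₂ p.1 p.2) hε₂.le,
        mul_le_mul_of_nonneg_left hcon hε₁.le])
  have small₂ := sum_mul_exp_lt_exp (Aᶜ ×ˢ B) (fun p => μ p.1 * ν p.2) (fun p => u₂ p.1 p.2)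
    (fun p _ => hw p) (hw1 _) (-L) (by
      intro p hp
      rw [Finset.mem_product, Finset.mem_compl] at hp
      have := hdown p.1 hp.1 p.2 hp.2
      by_contra! hcon
      nlinarith [mul_le_mul_of_nonneg_left (le₁ p.1 p.2) hε₁.le,
        mul_le_mul_of_nonneg_left hcon hε₂.le])
  rw [hexpL] at small₁ small₂
  have hAB : ∑ x ∈ A, μ x = ∑ y ∈ B, ν y := by
    obtain ⟨a, ha⟩ := exists_int_mul_sum_eq A M μ hμint
    obtain ⟨b, hb⟩ := exists_int_mul_sum_eq B M ν hνint
    have lt1 : ∑ x ∈ A, μ x - ∑ y ∈ B, ν y < 1 / M := by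
      rw [bal₁]
      linarith [nonneg (Aᶜ ×ˢ B) u₁]
    have lt2 : -(∑ x ∈ A, μ x - ∑ y ∈ B, ν y) < 1 / M := by
      rw [bal₂]
      linarith [nonneg (A ×ˢ Bᶜ) u₂]
    rw [lt_div_iff₀ hMR] at lt1 lt2
    have e1 : (a : ℝ) - b < 1 := by linarith
    have e2 : (b : ℝ) - a < 1 := by linarith
    have e3 : a - b < 1 := by exact_mod_cast e1
    have e4 : b - a < 1 := by exact_mod_cast e2
    have e5 : a = b := by omega
    rw [e5, ← hb] at ha
    exact mul_left_cancel₀ hMR.ne' ha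
  have posA : A.Nonempty ↔ 0 < ∑ x ∈ A, μ x := by
    refine ⟨fun hA => Finset.sum_pos (fun x _ => hμ x) hA, fun hA => ?_⟩
    by_contra hcon
    simp [Finset.not_nonempty_iff_eq_empty.1 hcon] at hA
  have posB : B.Nonempty ↔ 0 < ∑ y ∈ B, ν y := by
    refine ⟨fun hB => Finset.sum_pos (fun y _ => hν y) hB, fun hB => ?_⟩
    by_contra hcon
    simp [Finset.not_nonempty_iff_eq_empty.1 hcon] at hB
  have ltA : Aᶜ.Nonempty ↔ ∑ x ∈ A, μ x < 1 := by
    rw [← hμ1, ← Finset.sum_add_sum_compl A μ, lt_add_iff_pos_right]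
    refine ⟨fun hA => Finset.sum_pos (fun x _ => hμ x) hA, fun hA => ?_⟩
    by_contra hcon
    simp [Finset.not_nonempty_iff_eq_empty.1 hcon] at hA
  have ltB : Bᶜ.Nonempty ↔ ∑ y ∈ B, ν y < 1 := by
    rw [← hν1, ← Finset.sum_add_sum_compl B ν, lt_add_iff_pos_right]
    refine ⟨fun hB => Finset.sum_pos (fun y _ => hν y) hB, fun hB => ?_⟩
    by_contra hcon
    simp [Finset.not_nonempty_iff_eq_empty.1 hcon] at hB
  have hA_iff : A.Nonempty ↔ B.Nonempty := by rw [posA, posB, hAB]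
  have hAc_iff : Aᶜ.Nonempty ↔ Bᶜ.Nonempty := by rw [ltA, ltB, hAB]
  have neA : A.Nonempty := hne.elim id hA_iff.2
  have neB : B.Nonempty := hA_iff.1 neA
  have neAc : Aᶜ.Nonempty := hne'.elim (fun ⟨x, hx⟩ => ⟨x, Finset.mem_compl.2 hx⟩)
    fun ⟨y, hy⟩ => hAc_iff.2 ⟨y, Finset.mem_compl.2 hy⟩
  have neBc : Bᶜ.Nonempty := hAc_iff.1 neAc
  rw [hAB, sub_self, eq_comm, sub_eq_zero] at bal₁ bal₂
  obtain ⟨p, hp, hpl⟩ := exists_log_sum_mul_exp_le (A ×ˢ Bᶜ) (neA.product neBc)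
    (fun p => μ p.1 * ν p.2) (fun p => u₁ p.1 p.2) (fun p _ => hw p) (hw1 _)
  obtain ⟨q, hq, hql⟩ := exists_log_sum_mul_exp_le (Aᶜ ×ˢ B) (neAc.product neB)
    (fun p => μ p.1 * ν p.2) (fun p => u₂ p.1 p.2) (fun p _ => hw p) (hw1 _)
  have hpu := le_log_sum_mul_exp_add (A ×ˢ Bᶜ) (fun p => μ p.1 * ν p.2)
    (fun p => u₂ p.1 p.2) (fun p _ => hw p) (2 * L) p hp (hwL p)
  have hqu := le_log_sum_mul_exp_add (Aᶜ ×ˢ B) (fun p => μ p.1 * ν p.2)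
    (fun p => u₁ p.1 p.2) (fun p _ => hw p) (2 * L) q hq (hwL q)
  simp only [bal₁, bal₂] at hpl hql hpu hqu
  rw [Finset.mem_product, Finset.mem_compl] at hp hq
  have hP := hup p.1 hp.1 p.2 hp.2
  have hQ := hdown q.1 hq.1 q.2 hq.2
  have i1 := mul_le_mul_of_nonneg_left hpl hε₁.le
  have i2 := mul_le_mul_of_nonneg_left hql hε₂.le
  have i3 := mul_le_mul_of_nonneg_left hpu hε₂.le
  have i4 := mul_le_mul_of_nonneg_left hqu hε₁.le
  have i5 := mul_le_mul_of_nonneg_right hε.le hL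
  linarith


/-- Stability of optimal dual solutions of entropic optimal transport under
change of the regularization parameter (ε-scaling). -/
theorem dual_stability_eps_scaling
    {X Y : Type*} [Fintype X] [Fintype Y] [Nonempty X] [Nonempty Y]
    (μ : X → ℝ) (ν : Y → ℝ) (hμ : ∀ x, 0 < μ x) (hν : ∀ y, 0 < ν y)
    (hμ1 : ∑ x, μ x = 1) (hν1 : ∑ y, ν y = 1)
    (c : X → Y → ℝ) (hc : ∀ x y, 0 ≤ c x y)
    (N : ℕ) (hNX : Fintype.card X ≤ N) (hNY : Fintype.card Y ≤ N)
    (M : ℕ) (hM : 0 < M)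
    (hμint : ∀ x, ∃ k : ℕ, 0 < k ∧ (M : ℝ) * μ x = (k : ℝ))
    (hνint : ∀ y, ∃ k : ℕ, 0 < k ∧ (M : ℝ) * ν y = (k : ℝ))
    (ε₁ ε₂ : ℝ) (hε₂ : 0 < ε₂) (hε : ε₂ < ε₁)
    (J : ℝ → (X → ℝ) → (Y → ℝ) → ℝ)
    (hJ : ∀ ε α β, J ε α β = ∑ x, α x * μ x + ∑ y, β y * ν y -
      ε * ∑ x, ∑ y, μ x * ν y *
        (Real.exp ((α x + β y - c x y) / ε) - Real.exp (-(c x y) / ε)))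
    (α₁ : X → ℝ) (β₁ : Y → ℝ) (α₂ : X → ℝ) (β₂ : Y → ℝ)
    (hopt₁ : ∀ (α : X → ℝ) (β : Y → ℝ), J ε₁ α β ≤ J ε₁ α₁ β₁)
    (hopt₂ : ∀ (α : X → ℝ) (β : Y → ℝ), J ε₂ α β ≤ J ε₂ α₂ β₂) :
    Finset.univ.sup' Finset.univ_nonempty (fun x => α₂ x - α₁ x) -
      Finset.univ.inf' Finset.univ_nonempty (fun x => α₂ x - α₁ x) ≤
      ε₁ * N * (4 * Real.log N + 24 * Real.log M) ∧
    Finset.univ.sup' Finset.univ_nonempty (fun y => β₂ y - β₁ y) -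
      Finset.univ.inf' Finset.univ_nonempty (fun y => β₂ y - β₁ y) ≤
      ε₁ * N * (4 * Real.log N + 24 * Real.log M) := by
  have hL : 0 ≤ Real.log M := Real.log_natCast_nonneg M
  have hLN : 0 ≤ Real.log N := Real.log_natCast_nonneg N
  have hε₁ : 0 < ε₁ := hε₂.trans hε
  have hg : 0 ≤ 2 * ε₁ * Real.log M := by positivity
  have s₁ := entropic_dual_stationary μ ν c ε₁ hε₁ (J ε₁) (hJ ε₁) α₁ β₁ hopt₁
  have s₂ := entropic_dual_stationary μ ν c ε₂ hε₂ (J ε₂) (hJ ε₂) α₂ β₂ hopt₂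
  have hdiff : ∀ x y, ε₂ * ((α₂ x + β₂ y - c x y) / ε₂) - ε₁ * ((α₁ x + β₁ y - c x y) / ε₁) =
      (α₂ x - α₁ x) + (β₂ y - β₁ y) := fun x y => by
    field_simp
    ring
  have chain := sub_le_mul_card_of_gap_le
    (Sum.elim (fun x => α₂ x - α₁ x) (fun y => -(β₂ y - β₁ y))) (2 * ε₁ * Real.log M) hg (by
      intro i hi
      by_contra! hcon
      set t := Sum.elim (fun x => α₂ x - α₁ x) (fun y => -(β₂ y - β₁ y)) i with ht
      refine not_cut_separated μ ν hμ hν hμ1 hν1 M hM hμint hνint ε₁ ε₂ hε₂ hε _ _ s₁ s₂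
        (Finset.univ.filter fun x => t < α₂ x - α₁ x)
        (Finset.univ.filter fun y => t < -(β₂ y - β₁ y)) ?_ ?_ ?_ ?_
      · obtain ⟨x | y, hj⟩ := hi
        · exact Or.inl ⟨x, Finset.mem_filter.2 ⟨Finset.mem_univ _, hj⟩⟩
        · exact Or.inr ⟨y, Finset.mem_filter.2 ⟨Finset.mem_univ _, hj⟩⟩
      · rcases i with x | y
        · exact Or.inl ⟨x, fun hx => (Finset.mem_filter.1 hx).2.ne ht⟩
        · exact Or.inr ⟨y, fun hy => (Finset.mem_filter.1 hy).2.ne ht⟩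
      · intro x hx y hy
        rw [hdiff]
        simp only [Finset.mem_filter, Finset.mem_univ, true_and, not_lt] at hx hy
        have := hcon (Sum.inl x) hx
        simp only [Sum.elim_inl] at this
        linarith
      · intro x hx y hy
        rw [hdiff]
        simp only [Finset.mem_filter, Finset.mem_univ, true_and, not_lt] at hx hy
        have := hcon (Sum.inr y) hy
        simp only [Sum.elim_inr] at this
        linarith)
  have hbound : 2 * ε₁ * Real.log M * Fintype.card (X ⊕ Y) ≤
      ε₁ * N * (4 * Real.log N + 24 * Real.log M) := by
    have hcard : (Fintype.card (X ⊕ Y) : ℝ) ≤ 2 * N := by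
      rw [Fintype.card_sum]
      exact_mod_cast (by omega : Fintype.card X + Fintype.card Y ≤ 2 * N)
    have h1 := mul_le_mul_of_nonneg_left hcard hg
    have h2 : 0 ≤ ε₁ * N * Real.log N := by positivity
    have h3 : 0 ≤ ε₁ * N * Real.log M := by positivity
    linarith
  constructor
  · obtain ⟨a, -, ha⟩ := Finset.exists_mem_eq_sup' Finset.univ_nonempty fun x => α₂ x - α₁ x
    obtain ⟨b, -, hb⟩ := Finset.exists_mem_eq_inf' Finset.univ_nonempty fun x => α₂ x - α₁ x
    rw [ha, hb]
    exact (chain (Sum.inl b) (Sum.inl a)).trans hbound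
  · obtain ⟨a, -, ha⟩ := Finset.exists_mem_eq_sup' Finset.univ_nonempty fun y => β₂ y - β₁ y
    obtain ⟨b, -, hb⟩ := Finset.exists_mem_eq_inf' Finset.univ_nonempty fun y => β₂ y - β₁ y
    rw [ha, hb]
    have := (chain (Sum.inr a) (Sum.inr b)).trans hbound
    simp only [Sum.elim_inr] at this
    linarith
end
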